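/- Let f : ℝⁿ → ℝ be real analytic and nonnegative, and let p ∈ f⁻¹(0). Then there exist a neighborhood U of p and constants C > 0 and β ∈ (0,1) such that every gradient flow γ : [0,∞) → ℝⁿ of f with γ(0) = x₀ ∈ U converges as t → ∞, and its total arclength satisfies ∫_0^∞ ‖γ'(t)‖ dt ≤ C · dist(x₀, f⁻¹(0))^β. -/

import Mathlib

open Filter MeasureTheory
open Topology
open scoped ContDiff

/-- Telescoping identity for multilinear maps. -/
theorem telescope_multilinear {X : Type*} [NormedAddCommGroup X] [NormedSpace ℝ X]
    (n : ℕ) (p : ContinuousMultilinearMap ℝ (fun _ : Fin (n+1) => X) ℝ) (x w e : X) (c : ℝ)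
    (hx : x - w = c • e) :
    p (fun _ => x) - p (fun _ => w) =
      c * ∑ i : Fin (n+1), p (i.insertNth e (fun j : Fin n => if j.val < i.val then w else x)) := by
  let m : ℕ → Fin (n+1) → X := fun k j => if j.val < k then w else x
  have h0 : m 0 = fun _ => x := by funext j; simp [m]
  have h1 : m (n+1) = fun _ => w := by
    funext j; simp only [m, j.isLt, if_true]
  have hstep : ∀ i : Fin (n+1), p (m i) - p (m (i+1)) =
      c * p (i.insertNth e (fun j : Fin n => if j.val < i.val then w else x)) := by
    intro i
    have e1 : ∀ y : X, Function.update (m i) i y =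
        i.insertNth y (fun j : Fin n => if j.val < i.val then w else x) := by
      intro y
      funext j
      refine Fin.succAboveCases i ?_ (fun k => ?_) j
      · simp
      · rw [Function.update_of_ne (Fin.succAbove_ne i k), Fin.insertNth_apply_succAbove]
        simp only [m]
        by_cases hk : k.val < i.val
        · have : (i.succAbove k) = k.castSucc := Fin.succAbove_of_castSucc_lt _ _ (by
            simpa [Fin.lt_def] using hk)
          rw [this]; simp [hk]
        · have : (i.succAbove k) = k.succ := Fin.succAbove_of_le_castSucc _ _ (by
            simpa [Fin.le_def] using hk)
          rw [this]; simp only [Fin.val_succ]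
          rw [if_neg (by omega), if_neg hk]
    have e2 : m i = Function.update (m i) i x := by
      funext j; by_cases hj : j = i
      · subst hj; simp [m]
      · simp [Function.update_of_ne hj]
    have e3 : m (i+1) = Function.update (m i) i w := by
      funext j; by_cases hj : j = i
      · subst hj; simp [m]
      · rw [Function.update_of_ne hj]
        simp only [m]
        have : j.val ≠ i.val := fun h => hj (Fin.ext h)
        by_cases h : j.val < i.val
        · rw [if_pos h, if_pos (by omega)]
        · rw [if_neg h, if_neg (by omega)]
    rw [← e1, e3]
    nth_rewrite 1 [e2]
    rw [← ContinuousMultilinearMap.map_update_sub, hx, ContinuousMultilinearMap.map_update_smul]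
    simp
  rw [← h0, ← h1, Finset.mul_sum]
  have := Finset.sum_range_sub' (fun k => p (m k)) (n+1)
  rw [← this, Finset.sum_range]
  exact Finset.sum_congr rfl (fun i _ => hstep i)

theorem analytic_division {X : Type*} [NormedAddCommGroup X] [NormedSpace ℝ X]
    (l : X →L[ℝ] ℝ) (e : X) (f : X → ℝ) (hf : AnalyticAt ℝ f 0) :
    ∃ g : X → ℝ, AnalyticAt ℝ g 0 ∧ ∀ᶠ x in 𝓝 (0 : X), f x = f (x - l x • e) + l x * g x := by
  obtain ⟨p, r, hp⟩ := hf
  let P : X →L[ℝ] X := ContinuousLinearMap.id ℝ X - l.smulRight e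
  have hP : ∀ x, P x = x - l x • e := fun x => by simp [P]
  let L : (n : ℕ) → Fin (n+1) → Fin n → (X →L[ℝ] X) := fun n i j =>
    if j.val < i.val then P else ContinuousLinearMap.id ℝ X
  let q : FormalMultilinearSeries ℝ X ℝ := fun n =>
    ∑ i : Fin (n+1), (((p (n+1)).curryMid i e).compContinuousLinearMap (L n i))
  have hq : ∀ n x, q n (fun _ => x) = ∑ i : Fin (n+1),
      p (n+1) (i.insertNth e (fun j : Fin n => if j.val < i.val then P x else x)) := by
    intro n x
    simp only [q, _root_.sum_apply,
      ContinuousMultilinearMap.compContinuousLinearMap_apply,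
      ContinuousMultilinearMap.curryMid_apply]
    refine Finset.sum_congr rfl (fun i _ => ?_)
    congr 2
    funext j
    simp only [L]
    split_ifs <;> simp
  set M : ℝ := max 1 ‖P‖ with hM
  have hM1 : 1 ≤ M := le_max_left _ _
  have hM0 : 0 < M := by linarith
  have hqn : ∀ n, ‖q n‖ ≤ (n+1) * (‖p (n+1)‖ * ‖e‖ * M ^ n) := by
    intro n
    have : ∀ i : Fin (n+1), ‖((p (n+1)).curryMid i e).compContinuousLinearMap (L n i)‖
        ≤ ‖p (n+1)‖ * ‖e‖ * M ^ n := by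
      intro i
      refine (ContinuousMultilinearMap.norm_compContinuousLinearMap_le _ _).trans ?_
      gcongr
      · refine (ContinuousLinearMap.le_opNorm _ _).trans ?_
        rw [ContinuousMultilinearMap.norm_curryMid]
      · calc ∏ j, ‖L n i j‖ ≤ ∏ j : Fin n, M := by
              refine Finset.prod_le_prod (fun _ _ => norm_nonneg _) (fun j _ => ?_)
              simp only [L]
              split_ifs
              · exact le_max_right _ _
              · exact ContinuousLinearMap.norm_id_le.trans hM1
          _ = M ^ n := by simp
    refine (norm_sum_le _ _).trans ?_
    refine (Finset.sum_le_sum (fun i _ => this i)).trans ?_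
    simp
  have hprad : 0 < p.radius := hp.r_pos.trans_le hp.r_le
  obtain ⟨s, hs0, hs⟩ := ENNReal.lt_iff_exists_nnreal_btwn.1 hprad
  have hs0' : 0 < s := by exact_mod_cast hs0
  obtain ⟨C, hC, hbd⟩ := p.norm_mul_pow_le_of_lt_radius hs
  let s' : NNReal := s / (2 * ⟨M, hM0.le⟩)
  have hs' : 0 < s' := by
    apply div_pos hs0'
    apply mul_pos (by norm_num)
    exact_mod_cast hM0
  have hs'v : (s' : ℝ) = s / (2 * M) := by
    simp only [s', NNReal.coe_div, NNReal.coe_mul]; rfl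
  have hqrad : 0 < q.radius := by
    refine lt_of_lt_of_le (by exact_mod_cast hs') (q.le_radius_of_bound (C / s * ‖e‖) (r := s') ?_)
    intro n
    have h2n : ((n:ℝ)+1) ≤ 2 ^ n := by exact_mod_cast Nat.lt_two_pow_self (n := n)
    have hsr : (0:ℝ) < s := by exact_mod_cast hs0'
    have hb : ‖p (n+1)‖ * (s:ℝ)^n ≤ C / s := by
      rw [le_div_iff₀ hsr]; have := hbd (n+1); rw [pow_succ] at this; linarith
    calc ‖q n‖ * (s':ℝ)^n ≤ ((n+1) * (‖p (n+1)‖ * ‖e‖ * M ^ n)) * (s / (2*M))^n := by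
          rw [hs'v]; gcongr; exact hqn n
      _ ≤ (2^n * (‖p (n+1)‖ * ‖e‖ * M ^ n)) * (s / (2*M))^n := by gcongr
      _ = (‖p (n+1)‖ * s ^ n) * ‖e‖ := by
          rw [div_pow, mul_pow]; field_simp
      _ ≤ C / s * ‖e‖ := by gcongr
  have hqs := q.hasFPowerSeriesOnBall hqrad
  refine ⟨q.sum, hqs.analyticAt, ?_⟩
  have n1 : ∀ᶠ x in 𝓝 (0:X), x ∈ Metric.eball (0:X) r := Metric.eball_mem_nhds _ hp.r_pos
  have n2 : ∀ᶠ x in 𝓝 (0:X), P x ∈ Metric.eball (0:X) r := by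
    have : Tendsto P (𝓝 0) (𝓝 0) := by simpa using P.continuous.tendsto 0
    exact this (Metric.eball_mem_nhds _ hp.r_pos)
  have n3 : ∀ᶠ x in 𝓝 (0:X), x ∈ Metric.eball (0:X) q.radius := Metric.eball_mem_nhds _ hqrad
  filter_upwards [n1, n2, n3] with x h1 h2 h3
  have s1 := hp.hasSum h1
  have s2 := hp.hasSum h2
  have s3 := hqs.hasSum h3
  simp only [zero_add] at s1 s2 s3
  have s4 := s1.sub s2
  rw [← hasSum_nat_add_iff' 1] at s4
  have s5 := s3.mul_left (l x)
  have : (fun n => l x * q n (fun _ => x)) =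
      fun n => (p (n+1) fun _ => x) - p (n+1) fun _ => P x := by
    funext n
    rw [hq, telescope_multilinear n (p (n+1)) x (P x) e (l x) (by rw [hP]; abel)]
  rw [this] at s5
  have := s5.unique s4
  rw [← hP]
  have hz : (p 0 fun _ : Fin 0 => x) = p 0 (fun _ => P x) := by
    congr 1; funext i; exact i.elim0
  simp [hz] at this
  linarith

/-- The ring of germs of analytic functions is a domain. -/
theorem germ_domain {X : Type*} [NormedAddCommGroup X] [NormedSpace ℝ X]
    {f g : X → ℝ} (hf : AnalyticAt ℝ f 0) (hg : AnalyticAt ℝ g 0)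
    (h : ∀ᶠ x in 𝓝 (0:X), f x * g x = 0) :
    (∀ᶠ x in 𝓝 (0:X), f x = 0) ∨ (∀ᶠ x in 𝓝 (0:X), g x = 0) := by
  have := (hf.eventually_analyticAt.and hg.eventually_analyticAt).and h
  obtain ⟨ε, hε, hb⟩ := Metric.eventually_nhds_iff_ball.1 this
  by_cases hz : ∀ᶠ x in 𝓝 (0:X), f x = 0
  · exact Or.inl hz
  right
  have hfr : ∃ x ∈ Metric.ball (0:X) ε, f x ≠ 0 := by
    by_contra hcon
    push Not at hcon
    exact hz (Filter.mem_of_superset (Metric.ball_mem_nhds _ hε) hcon)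
  obtain ⟨x, hx, hfx⟩ := hfr
  have hgx : g =ᶠ[𝓝 x] 0 := by
    have h1 : ∀ᶠ y in 𝓝 x, f y ≠ 0 := (hb x hx).1.1.continuousAt.eventually_ne hfx
    filter_upwards [h1, Metric.isOpen_ball.mem_nhds hx] with y hy hyb
    have := (hb y hyb).2
    simpa [hy] using this
  have hgo : AnalyticOnNhd ℝ g (Metric.ball (0:X) ε) := fun y hy => (hb y hy).1.2
  have := hgo.eqOn_zero_of_preconnected_of_eventuallyEq_zero
    (convex_ball (0:X) ε).isPreconnected hx hgx
  exact Filter.mem_of_superset (Metric.ball_mem_nhds _ hε) this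

theorem germ_cancel {X : Type*} [NormedAddCommGroup X] [NormedSpace ℝ X]
    {f g k : X → ℝ} (hf : AnalyticAt ℝ f 0) (hg : AnalyticAt ℝ g 0) (hk : AnalyticAt ℝ k 0)
    (h : ∀ᶠ x in 𝓝 (0:X), f x * g x = f x * k x) (hne : ¬ ∀ᶠ x in 𝓝 (0:X), f x = 0) :
    ∀ᶠ x in 𝓝 (0:X), g x = k x := by
  have := (germ_domain hf (hg.sub hk) (by
    filter_upwards [h] with x hx
    simp only [Pi.sub_apply]; linarith)).resolve_left hne
  filter_upwards [this] with x hx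
  simp only [Pi.sub_apply] at hx; linarith

/-- finite-order Taylor expansion with parameters -/
theorem taylor_param {X : Type*} [NormedAddCommGroup X] [NormedSpace ℝ X]
    (d : ℕ) : ∀ (F : X × ℝ → ℝ), AnalyticAt ℝ F 0 →
    ∃ (c : ℕ → X → ℝ) (u : X × ℝ → ℝ), (∀ i, AnalyticAt ℝ (c i) 0) ∧ AnalyticAt ℝ u 0 ∧
      ∀ᶠ z in 𝓝 (0 : X × ℝ), F z = (∑ i ∈ Finset.range d, c i z.1 * z.2 ^ i) + z.2 ^ d * u z := by
  induction d with
  | zero => intro F hF; exact ⟨fun _ _ => 0, F, fun i => analyticAt_const, hF, by simp⟩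
  | succ d ih =>
    intro F hF
    obtain ⟨c, u, hc, hu, h⟩ := ih F hF
    obtain ⟨g, hg, hg'⟩ := analytic_division (ContinuousLinearMap.snd ℝ X ℝ) (0, 1) u hu
    refine ⟨fun i => if i = d then fun x => u (x, 0) else c i, g, ?_, hg, ?_⟩
    · intro i
      dsimp only
      split_ifs
      · have : AnalyticAt ℝ u ((0:X), (0:ℝ)) := hu
        exact AnalyticAt.fun_comp (g := u) (f := fun x : X => (x, (0:ℝ))) this
          (analyticAt_id.prod analyticAt_const)
      · exact hc i
    · filter_upwards [h, hg'] with z h1 h2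
      rw [h1, h2, Finset.sum_range_succ]
      have : z - (ContinuousLinearMap.snd ℝ X ℝ) z • ((0:X), (1:ℝ)) = (z.1, 0) := by
        ext <;> simp
      rw [this]
      have e : ∑ i ∈ Finset.range d, (if i = d then fun x => u (x, 0) else c i) z.1 * z.2 ^ i
          = ∑ i ∈ Finset.range d, c i z.1 * z.2 ^ i := by
        refine Finset.sum_congr rfl (fun i hi => ?_)
        rw [if_neg (by simp at hi; omega)]
      rw [e]
      simp
      ring

@[fun_prop]
theorem an_fst {X Y Z : Type*} [NormedAddCommGroup X] [NormedSpace ℝ X] [NormedAddCommGroup Y]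
    [NormedSpace ℝ Y] [NormedAddCommGroup Z] [NormedSpace ℝ Z] {f : X → Y × Z} {x : X}
    (hf : AnalyticAt ℝ f x) : AnalyticAt ℝ (fun z => (f z).1) x :=
  AnalyticAt.fun_comp (g := Prod.fst) analyticAt_fst hf

@[fun_prop]
theorem an_snd {X Y Z : Type*} [NormedAddCommGroup X] [NormedSpace ℝ X] [NormedAddCommGroup Y]
    [NormedSpace ℝ Y] [NormedAddCommGroup Z] [NormedSpace ℝ Z] {f : X → Y × Z} {x : X}
    (hf : AnalyticAt ℝ f x) : AnalyticAt ℝ (fun z => (f z).2) x :=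
  AnalyticAt.fun_comp (g := Prod.snd) analyticAt_snd hf

theorem an_comp0 {X Y Z : Type*} [NormedAddCommGroup X] [NormedSpace ℝ X] [NormedAddCommGroup Y]
    [NormedSpace ℝ Y] [NormedAddCommGroup Z] [NormedSpace ℝ Z] {g : Y → Z} {f : X → Y}
    (hg : AnalyticAt ℝ g 0) (hf : AnalyticAt ℝ f 0) (h0 : f 0 = 0) :
    AnalyticAt ℝ (fun z => g (f z)) 0 :=
  AnalyticAt.fun_comp (g := g) (f := f) (by rwa [h0]) hf

theorem an_tendsto0 {X Y : Type*} [NormedAddCommGroup X] [NormedSpace ℝ X] [NormedAddCommGroup Y]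
    [NormedSpace ℝ Y] {f : X → Y} (hf : AnalyticAt ℝ f 0) (h0 : f 0 = 0) :
    Tendsto f (𝓝 0) (𝓝 0) := by
  have := hf.continuousAt.tendsto
  rwa [h0] at this


theorem coeff_eq_iteratedDeriv (d : ℕ) (b w : ℝ → ℝ) (c : ℕ → ℝ) (hb : AnalyticAt ℝ b 0)
    (hw : AnalyticAt ℝ w 0)
    (h : ∀ᶠ t in 𝓝 (0:ℝ), b t = (∑ i ∈ Finset.range d, c i * t ^ i) + t ^ d * w t) :
    ∀ i < d, iteratedDeriv i b 0 = i.factorial * c i := by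
  have hP : AnalyticAt ℝ (fun t : ℝ => ∑ i ∈ Finset.range d, c i * t ^ i) 0 := by
    refine Finset.analyticAt_fun_sum _ fun i hi ↦ ?_
    fun_prop
  have h1 : (d : ℕ∞) ≤ analyticOrderAt (fun t => b t - ∑ i ∈ Finset.range d, c i * t ^ i) 0 := by
    rw [natCast_le_analyticOrderAt (hb.fun_sub hP)]
    refine ⟨w, hw, ?_⟩
    filter_upwards [h] with t ht
    rw [ht]; simp
  rw [natCast_le_analyticOrderAt_iff_iteratedDeriv_eq_zero (hb.fun_sub hP)] at h1
  intro i hi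
  have := h1 i hi
  rw [iteratedDeriv_fun_sub (hb.contDiffAt) hP.contDiffAt, sub_eq_zero] at this
  rw [this]
  simp (disch := fun_prop) only [iteratedDeriv_fun_sum]
  have e : ∀ j, iteratedDeriv i (fun t : ℝ => c j * t ^ j) 0 = c j * iteratedDeriv i (fun t : ℝ => t ^ j) 0 := by
    intro j
    exact iteratedDeriv_const_mul_field (c j) _
  simp only [e, iteratedDeriv_fun_pow_zero]
  simp [Finset.sum_ite_eq_of_mem _ _ _ (Finset.mem_range.mpr hi), mul_comm, hi]

theorem analytic_implicit {E : Type*} [NormedAddCommGroup E] [NormedSpace ℝ E] [CompleteSpace E]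
    (K : E × ℝ → ℝ) (hK : AnalyticAt ℝ K 0) (hK0 : K 0 = 0)
    (hd : deriv (fun s => K (0, s)) 0 ≠ 0) :
    ∃ φ : E → ℝ, AnalyticAt ℝ φ 0 ∧ φ 0 = 0 ∧ ∀ᶠ x in 𝓝 (0:E), K (x, φ x) = 0 := by
  have cdf : ContDiffAt ℝ ω K 0 := hK.contDiffAt
  have hder : HasDerivAt (fun s : ℝ => K (0, s)) (fderiv ℝ K 0 (0, 1)) 0 := by
    have h1 : HasFDerivAt K (fderiv ℝ K 0) ((0:E), (0:ℝ)) := hK.differentiableAt.hasFDerivAt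
    have h2 : HasDerivAt (fun s : ℝ => ((0:E), s)) ((0:E), (1:ℝ)) 0 :=
      (hasDerivAt_const _ _).prodMk (hasDerivAt_id _)
    exact h1.comp_hasDerivAt (0:ℝ) h2
  rw [hder.deriv] at hd
  have hinv : (fderiv ℝ K 0 ∘L .inr ℝ E ℝ).IsInvertible := by
    refine ⟨ContinuousLinearEquiv.unitsEquivAut ℝ (Units.mk0 _ hd), ?_⟩
    ext
    simp
  refine ⟨cdf.implicitFunction (by simp) hinv, ?_, ?_, ?_⟩
  · have := cdf.contDiffAt_implicitFunction (by simp) hinv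
    exact this.analyticAt
  · exact cdf.implicitFunction_apply_self (by simp) hinv
  · have := cdf.eventually_apply_implicitFunction (by simp) hinv
    rw [hK0] at this
    exact this

theorem tschirnhaus {E : Type*} [NormedAddCommGroup E] [NormedSpace ℝ E] [CompleteSpace E]
    (F : E × ℝ → ℝ) (hF : AnalyticAt ℝ F 0) (d : ℕ) (hd : 1 ≤ d) (v : ℝ → ℝ)
    (hv : AnalyticAt ℝ v 0) (hv0 : v 0 ≠ 0) (h : ∀ᶠ t in 𝓝 (0:ℝ), F (0, t) = t ^ d * v t) :
    ∃ (φ : E → ℝ) (c : ℕ → E → ℝ) (u : E × ℝ → ℝ), AnalyticAt ℝ φ 0 ∧ φ 0 = 0 ∧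
      (∀ i, AnalyticAt ℝ (c i) 0) ∧ (∀ i < d, c i 0 = 0) ∧ AnalyticAt ℝ u 0 ∧ u 0 ≠ 0 ∧
      (∀ᶠ x in 𝓝 (0:E), c (d-1) x = 0) ∧
      ∀ᶠ z in 𝓝 (0 : E × ℝ), F (z.1, z.2 + φ z.1) =
        (∑ i ∈ Finset.range d, c i z.1 * z.2 ^ i) + z.2 ^ d * u z := by
  have hF' : AnalyticAt ℝ F ((0:E), (0:ℝ)) := hF
  -- expand at moving basepoint
  let G : (E × ℝ) × ℝ → ℝ := fun z => F (z.1.1, z.1.2 + z.2)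
  have hG : AnalyticAt ℝ G 0 := by
    exact an_comp0 (g := F) (f := fun z : (E × ℝ) × ℝ => (z.1.1, z.1.2 + z.2)) hF (by fun_prop)
      (by simp)
  obtain ⟨C, U, hC, hU, hexp⟩ := taylor_param d G hG
  let a : ℝ → ℝ := fun s => F (0, s)
  have ha : AnalyticAt ℝ a 0 := by
    refine AnalyticAt.fun_comp (g := F) (f := fun s : ℝ => ((0:E), s)) hF' (by fun_prop)
  have hord : analyticOrderAt a 0 = d := by
    rw [ha.analyticOrderAt_eq_natCast]
    refine ⟨v, hv, hv0, ?_⟩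
    filter_upwards [h] with t ht
    simp [a, ht]
  -- identify C (d-1) (0,s)
  have hCs : ∀ᶠ s in 𝓝 (0:ℝ), ∀ i < d, iteratedDeriv i a s = i.factorial * C i (0, s) := by
    have hUn := hU.eventually_analyticAt
    have hboth := (hUn.and hexp).eventually_nhds
    have ht : Tendsto (fun s : ℝ => (((0:E), s), (0:ℝ))) (𝓝 0) (𝓝 0) := by
      exact an_tendsto0 (by fun_prop) (by simp)
    filter_upwards [ht.eventually hboth, ha.eventually_analyticAt] with s hs has i hi
    have hs1 : AnalyticAt ℝ U (((0:E), s), (0:ℝ)) := hs.self_of_nhds.1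
    have hw : AnalyticAt ℝ (fun t : ℝ => U (((0:E), s), t)) 0 :=
      AnalyticAt.fun_comp (g := U) (f := fun t : ℝ => (((0:E), s), t)) hs1 (by fun_prop)
    have hb : AnalyticAt ℝ (fun t : ℝ => a (s + t)) 0 := by
      refine AnalyticAt.fun_comp (g := a) (f := fun t : ℝ => s + t) (by simpa using has) (by fun_prop)
    have ht2 : Tendsto (fun t : ℝ => (((0:E), s), t)) (𝓝 0) (𝓝 (((0:E), s), (0:ℝ))) := by
      have : Continuous (fun t : ℝ => (((0:E), s), t)) := by fun_prop
      simpa using this.tendsto 0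
    have := coeff_eq_iteratedDeriv d (fun t => a (s + t)) _ (fun i => C i (0, s)) hb hw (by
      filter_upwards [ht2.eventually hs] with t ht
      exact ht.2) i hi
    rw [← this]
    have := iteratedDeriv_comp_const_add i a s
    rw [this]; simp
  have hCd : ∀ᶠ s in 𝓝 (0:ℝ), iteratedDeriv (d-1) a s = (d-1).factorial * C (d-1) (0, s) := by
    filter_upwards [hCs] with s hs
    exact hs (d-1) (by omega)
  have hfac : ((d-1).factorial : ℝ) ≠ 0 := by exact_mod_cast Nat.factorial_ne_zero _
  have hordd : analyticOrderAt (iteratedDeriv (d-1) a) 0 = 1 := by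
    rw [iteratedDeriv_eq_iterate]
    have := analyticOrderAt_iterated_deriv ha (k := d-1) (n := d) hord.symm (by omega) (by omega)
    rw [this]
    have : d - (d-1) = 1 := by omega
    rw [this]; rfl
  have hita : AnalyticAt ℝ (iteratedDeriv (d-1) a) 0 := by
    rw [iteratedDeriv_eq_iterate]; exact ha.iterated_deriv _
  have hz0 : iteratedDeriv (d-1) a 0 = 0 := by
    by_contra hne
    have := analyticOrderAt_eq_zero.2 (Or.inr hne)
    rw [this] at hordd; exact zero_ne_one hordd
  have hz1 : deriv (iteratedDeriv (d-1) a) 0 ≠ 0 := by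
    intro h0
    have : ((2:ℕ) : ℕ∞) ≤ analyticOrderAt (iteratedDeriv (d-1) a) 0 := by
      rw [natCast_le_analyticOrderAt_iff_iteratedDeriv_eq_zero hita]
      intro i hi
      interval_cases i
      · simpa using hz0
      · simpa using h0
    rw [hordd] at this
    exact absurd this (by decide)
  have hKderiv : deriv (fun s => C (d-1) (0, s)) 0 ≠ 0 := by
    intro h0
    apply hz1
    have e : iteratedDeriv (d-1) a =ᶠ[𝓝 0] fun s => (d-1).factorial * C (d-1) (0, s) := hCd
    rw [e.deriv_eq, deriv_const_mul_field, h0, mul_zero]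
  have hK0 : C (d-1) 0 = 0 := by
    have := hCd.self_of_nhds
    rw [hz0] at this
    have := (mul_eq_zero.1 this.symm).resolve_left hfac
    exact this
  obtain ⟨φ, hφ, hφ0, hφz⟩ := analytic_implicit (C (d-1)) (hC _) hK0 hKderiv
  have hpair : AnalyticAt ℝ (fun x : E => (x, φ x)) 0 := analyticAt_id.prod hφ
  have hpair0 : ((0:E), φ 0) = 0 := by rw [hφ0]; rfl
  have hm : AnalyticAt ℝ (fun z : E × ℝ => ((z.1, φ z.1), z.2)) 0 := by
    have h1 : AnalyticAt ℝ (fun z : E × ℝ => φ z.1) 0 :=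
      AnalyticAt.fun_comp (g := φ) (f := Prod.fst) hφ analyticAt_fst
    exact (analyticAt_fst.prod h1).prod analyticAt_snd
  have hm0 : (fun z : E × ℝ => ((z.1, φ z.1), z.2)) 0 = 0 := by simp [hφ0]
  let c : ℕ → E → ℝ := fun i x => C i (x, φ x)
  let u : E × ℝ → ℝ := fun z => U ((z.1, φ z.1), z.2)
  have hc : ∀ i, AnalyticAt ℝ (c i) 0 := fun i =>
    AnalyticAt.fun_comp (g := C i) (f := fun x : E => (x, φ x)) (by simpa [hpair0] using hC i) hpair
  have hu : AnalyticAt ℝ u 0 :=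
    an_comp0 (g := U) (f := fun z : E × ℝ => ((z.1, φ z.1), z.2)) hU hm hm0
  have hexp2 : ∀ᶠ z in 𝓝 (0 : E × ℝ), F (z.1, z.2 + φ z.1) =
        (∑ i ∈ Finset.range d, c i z.1 * z.2 ^ i) + z.2 ^ d * u z := by
    have ht : Tendsto (fun z : E × ℝ => ((z.1, φ z.1), z.2)) (𝓝 0) (𝓝 0) := by
      exact an_tendsto0 hm hm0
    filter_upwards [ht.eventually hexp] with z hz
    simp only [G] at hz
    rw [add_comm z.2]
    exact hz
  have hslice : ∀ᶠ t in 𝓝 (0:ℝ), t ^ d * v t =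
        (∑ i ∈ Finset.range d, c i 0 * t ^ i) + t ^ d * u (0, t) := by
    have ht : Tendsto (fun t : ℝ => ((0:E), t)) (𝓝 0) (𝓝 0) := by
      exact an_tendsto0 (by fun_prop) (by simp)
    filter_upwards [ht.eventually hexp2, h] with t h1 h2
    rw [← h2]
    simpa [hφ0] using h1
  have hus : AnalyticAt ℝ (fun t : ℝ => u (0, t)) 0 :=
    AnalyticAt.fun_comp (g := u) (f := fun t : ℝ => ((0:E), t)) hu (by fun_prop)
  have hvs : AnalyticAt ℝ (fun t : ℝ => t ^ d * v t) 0 := by fun_prop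
  have hc0 : ∀ i < d, c i 0 = 0 := by
    intro i hi
    have h1 := coeff_eq_iteratedDeriv d (fun t : ℝ => t ^ d * v t) _ (fun i => c i 0) hvs hus hslice i hi
    have h2 := coeff_eq_iteratedDeriv d (fun t : ℝ => t ^ d * v t) v (fun _ => 0) hvs hv (by simp) i hi
    rw [h2] at h1
    have hfi : (i.factorial : ℝ) ≠ 0 := by exact_mod_cast Nat.factorial_ne_zero _
    simpa [hfi] using h1.symm
  refine ⟨φ, c, u, hφ, hφ0, hc, hc0, hu, ?_, hφz, hexp2⟩
  have : ∀ᶠ t in 𝓝 (0:ℝ), v t = u (0, t) := by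
    refine germ_cancel (f := fun t : ℝ => t ^ d) (by fun_prop) hv hus ?_ ?_
    · filter_upwards [hslice] with t ht
      rw [ht, Finset.sum_eq_zero]
      · simp
      · intro i hi; rw [hc0 i (Finset.mem_range.1 hi)]; simp
    · intro hz
      have h1 : ∀ᶠ t in 𝓝[≠] (0:ℝ), t ^ d = 0 := hz.filter_mono nhdsWithin_le_nhds
      obtain ⟨t, ht, ht'⟩ := (h1.and self_mem_nhdsWithin).exists
      exact ht' (pow_eq_zero_iff (by omega) |>.1 ht)
  have := this.self_of_nhds
  intro hu0
  exact hv0 (this.trans hu0)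


/-- normal crossing germs with respect to a family of coordinates -/
def NC {X κ : Type*} [NormedAddCommGroup X] [NormedSpace ℝ X] [Fintype κ] (l : κ → X →L[ℝ] ℝ)
    (g : X → ℝ) : Prop :=
  ∃ α : κ → ℕ, ∃ u : X → ℝ, AnalyticAt ℝ u 0 ∧ u 0 ≠ 0 ∧
    ∀ᶠ y in 𝓝 (0:X), g y = (∏ i, l i y ^ α i) * u y

section
variable {X κ : Type*} [NormedAddCommGroup X] [NormedSpace ℝ X] [Fintype κ]
  {l : κ → X →L[ℝ] ℝ}

theorem an_mono (l : κ → X →L[ℝ] ℝ) (α : κ → ℕ) (x : X) :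
    AnalyticAt ℝ (fun y => ∏ i, l i y ^ α i) x :=
  Finset.analyticAt_fun_prod _ fun i _ => ((l i).analyticAt x).fun_pow _

theorem NC.unit {u : X → ℝ} (hu : AnalyticAt ℝ u 0) (h0 : u 0 ≠ 0) : NC l u :=
  ⟨0, u, hu, h0, by simp⟩

theorem NC.coord [DecidableEq κ] (k : κ) : NC l (fun y => l k y) := by
  refine ⟨Pi.single k 1, fun _ => 1, analyticAt_const, one_ne_zero, Eventually.of_forall fun y => ?_⟩
  rw [Finset.prod_eq_single k]
  · simp
  · intro b _ hb; simp [hb]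
  · simp

theorem NC.mono (α : κ → ℕ) : NC l (fun y => ∏ i, l i y ^ α i) :=
  ⟨α, fun _ => 1, analyticAt_const, one_ne_zero, by simp⟩

theorem NC.mul {f g : X → ℝ} (hf : NC l f) (hg : NC l g) : NC l (fun y => f y * g y) := by
  obtain ⟨α, u, hu, hu0, h⟩ := hf
  obtain ⟨β, v, hv, hv0, h'⟩ := hg
  refine ⟨α + β, fun y => u y * v y, hu.fun_mul hv, mul_ne_zero hu0 hv0, ?_⟩
  filter_upwards [h, h'] with y h1 h2
  simp only [h1, h2, Pi.add_apply, pow_add, Finset.prod_mul_distrib]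
  ring

theorem NC.one : NC l (fun _ => 1) := NC.unit analyticAt_const one_ne_zero

theorem NC.pow {f : X → ℝ} (hf : NC l f) (m : ℕ) : NC l (fun y => f y ^ m) := by
  induction m with
  | zero => simpa using NC.one
  | succ m ih => simpa [pow_succ] using ih.mul hf

theorem NC.prod {ι : Type*} (s : Finset ι) {f : ι → X → ℝ} (hf : ∀ i ∈ s, NC l (f i)) :
    NC l (fun y => ∏ i ∈ s, f i y) := by
  classical
  induction s using Finset.induction_on with
  | empty => simpa using NC.one
  | insert a s ha ih =>
    simp only [Finset.prod_insert ha]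
    exact (hf a (by simp)).mul (ih fun i hi => hf i (by simp [hi]))

theorem NC.congr {f g : X → ℝ} (hf : NC l f) (h : ∀ᶠ y in 𝓝 0, f y = g y) : NC l g := by
  obtain ⟨α, u, hu, hu0, h'⟩ := hf
  refine ⟨α, u, hu, hu0, ?_⟩
  filter_upwards [h, h'] with y h1 h2
  rw [← h1, h2]

theorem NC.analytic {f : X → ℝ} (hf : NC l f) : AnalyticAt ℝ f 0 := by
  obtain ⟨α, u, hu, hu0, h'⟩ := hf
  exact ((an_mono l α 0).fun_mul hu).congr (h'.mono fun y h => h.symm)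

theorem linear_germ_ne {l : X →L[ℝ] ℝ} (hl : l ≠ 0) : ¬ ∀ᶠ y in 𝓝 0, l y = 0 := by
  intro h
  apply hl
  ext v
  have : Tendsto (fun t : ℝ => t • v) (𝓝[>] 0) (𝓝 0) := by
    have : Tendsto (fun t : ℝ => t • v) (𝓝 0) (𝓝 ((0:ℝ) • v)) :=
      (continuous_id.smul continuous_const).tendsto _
    rw [zero_smul] at this
    exact this.mono_left nhdsWithin_le_nhds
  obtain ⟨t, ht, ht0⟩ := ((this.eventually h).and self_mem_nhdsWithin).exists
  simp at ht
  rcases ht with ht | ht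
  · exact absurd ht (ne_of_gt ht0)
  · simpa using ht

theorem germ_prod_ne {ι : Type*} (s : Finset ι) {f : ι → X → ℝ} (hf : ∀ i ∈ s, AnalyticAt ℝ (f i) 0)
    (hne : ∀ i ∈ s, ¬ ∀ᶠ y in 𝓝 0, f i y = 0) : ¬ ∀ᶠ y in 𝓝 0, ∏ i ∈ s, f i y = 0 := by
  classical
  induction s using Finset.induction_on with
  | empty =>
    intro h
    exact one_ne_zero (α := ℝ) (by simpa using h.self_of_nhds)
  | insert a s ha ih =>
    intro h
    simp only [Finset.prod_insert ha] at h
    rcases germ_domain (hf a (by simp)) (Finset.analyticAt_fun_prod s fun i hi => hf i (by simp [hi])) h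
      with h | h
    · exact hne a (by simp) h
    · exact ih (fun i hi => hf i (by simp [hi])) (fun i hi => hne i (by simp [hi])) h

theorem germ_pow_ne {f : X → ℝ} (hne : ¬ ∀ᶠ y in 𝓝 0, f y = 0) (m : ℕ) :
    ¬ ∀ᶠ y in 𝓝 0, f y ^ m = 0 := by
  intro h
  exact hne (h.mono fun y hy => eq_zero_of_pow_eq_zero hy)

theorem unit_germ_ne {u : X → ℝ} (hu : AnalyticAt ℝ u 0) (hu0 : u 0 ≠ 0) :
    ¬ ∀ᶠ y in 𝓝 0, u y = 0 := fun h => hu0 h.self_of_nhds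

theorem mono_germ_ne (hl : ∀ i, l i ≠ 0) (α : κ → ℕ) : ¬ ∀ᶠ y in 𝓝 0, ∏ i, l i y ^ α i = 0 :=
  germ_prod_ne _ (fun i _ => ((l i).analyticAt 0).fun_pow _)
    (fun i _ => germ_pow_ne (linear_germ_ne (hl i)) _)

theorem germ_mul_ne {f g : X → ℝ} (hf : AnalyticAt ℝ f 0) (hg : AnalyticAt ℝ g 0)
    (h1 : ¬ ∀ᶠ y in 𝓝 0, f y = 0) (h2 : ¬ ∀ᶠ y in 𝓝 0, g y = 0) :
    ¬ ∀ᶠ y in 𝓝 0, f y * g y = 0 := fun h => (germ_domain hf hg h).elim h1 h2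

theorem NC.ne (hl : ∀ i, l i ≠ 0) {f : X → ℝ} (hf : NC l f) : ¬ ∀ᶠ y in 𝓝 0, f y = 0 := by
  obtain ⟨α, u, hu, hu0, h'⟩ := hf
  intro h
  refine germ_mul_ne (an_mono l α 0) hu (mono_germ_ne hl α) (unit_germ_ne hu hu0) ?_
  filter_upwards [h, h'] with y h1 h2
  rw [← h2, h1]

theorem NC.comp {Y μ : Type*} [NormedAddCommGroup Y] [NormedSpace ℝ Y] [Fintype μ]
    {m : μ → Y →L[ℝ] ℝ} {f : X → ℝ} (hf : NC l f) {τ : Y → X} (hτ : AnalyticAt ℝ τ 0)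
    (h0 : τ 0 = 0) (h : ∀ i, NC m (fun y => l i (τ y))) : NC m (fun y => f (τ y)) := by
  obtain ⟨α, u, hu, hu0, h'⟩ := hf
  have h1 : NC m (fun y => (∏ i, l i (τ y) ^ α i) * u (τ y)) :=
    (NC.prod _ fun i _ => (h i).pow _).mul (NC.unit (an_comp0 hu hτ h0) (by rwa [h0]))
  refine h1.congr ?_
  filter_upwards [(an_tendsto0 hτ h0).eventually h'] with y hy
  rw [hy]
end

/-- coordinates on `Fin n → ℝ` -/
noncomputable abbrev cE (n : ℕ) : Fin n → (Fin n → ℝ) →L[ℝ] ℝ := fun i => ContinuousLinearMap.proj i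

theorem cE_ne (n : ℕ) (i : Fin n) : cE n i ≠ 0 := by
  intro h
  have := congrArg (fun L : (Fin n → ℝ) →L[ℝ] ℝ => L (fun _ => 1)) h
  simp at this

theorem factor_aux {n : ℕ} (m : ℕ) : ∀ (α : Fin n → ℕ) (f g u : (Fin n → ℝ) → ℝ), ∑ i, α i = m →
    AnalyticAt ℝ f 0 → AnalyticAt ℝ g 0 → AnalyticAt ℝ u 0 → u 0 ≠ 0 →
    (∀ᶠ y in 𝓝 0, f y * g y = (∏ i, cE n i y ^ α i) * u y) → NC (cE n) f ∧ NC (cE n) g := by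
  induction m with
  | zero =>
    intro α f g u hα hf hg hu hu0 h
    have hα' : ∀ i, α i = 0 := by simpa using hα
    simp only [hα', pow_zero, Finset.prod_const_one, one_mul] at h
    have := h.self_of_nhds
    rw [← this] at hu0
    exact ⟨NC.unit hf (left_ne_zero_of_mul hu0), NC.unit hg (right_ne_zero_of_mul hu0)⟩
  | succ m ih =>
    intro α f g u hα hf hg hu hu0 h
    obtain ⟨k, hk⟩ : ∃ k, α k ≠ 0 := by
      by_contra hcon
      push Not at hcon
      simp [hcon] at hα
    set α' : Fin n → ℕ := Function.update α k (α k - 1) with hα'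
    have hmono : ∀ y, ∏ i, cE n i y ^ α i = cE n k y * ∏ i, cE n i y ^ α' i := by
      intro y
      rw [← Finset.mul_prod_erase _ _ (Finset.mem_univ k),
        ← Finset.mul_prod_erase _ (fun i => cE n i y ^ α' i) (Finset.mem_univ k), ← mul_assoc]
      congr 1
      · simp only [hα', Function.update_self]
        rw [← pow_succ']; congr 1; omega
      · apply Finset.prod_congr rfl
        intro i hi
        rw [hα', Function.update_of_ne (Finset.ne_of_mem_erase hi)]
    have hsum : ∑ i, α' i = m := by
      rw [← Finset.add_sum_erase _ _ (Finset.mem_univ k)] at hα ⊢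
      have : ∑ x ∈ Finset.univ.erase k, α' x = ∑ x ∈ Finset.univ.erase k, α x := by
        apply Finset.sum_congr rfl
        intro i hi
        rw [hα', Function.update_of_ne (Finset.ne_of_mem_erase hi)]
      rw [this, hα', Function.update_self]
      omega
    -- symmetric core
    have core : ∀ f g : (Fin n → ℝ) → ℝ, AnalyticAt ℝ f 0 → AnalyticAt ℝ g 0 →
        (∀ᶠ y in 𝓝 0, f y * g y = (∏ i, cE n i y ^ α i) * u y) →
        (∀ᶠ y in 𝓝 (0 : Fin n → ℝ), f (y - cE n k y • Pi.single k (1:ℝ)) = 0) →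
        NC (cE n) f ∧ NC (cE n) g := by
      intro f g hf hg h hv
      obtain ⟨f', hf', hdiv⟩ := analytic_division (cE n k) (Pi.single k (1:ℝ)) f hf
      have hff : ∀ᶠ y in 𝓝 0, f y = cE n k y * f' y := by
        filter_upwards [hdiv, hv] with y h1 h2
        rw [h1, h2, zero_add]
      have h2 : ∀ᶠ y in 𝓝 0, f' y * g y = (∏ i, cE n i y ^ α' i) * u y := by
        refine germ_cancel ((cE n k).analyticAt 0) (hf'.fun_mul hg)
          ((an_mono _ _ _).fun_mul hu) ?_ (linear_germ_ne (cE_ne n k))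
        filter_upwards [h, hff] with y h1 h2
        rw [← mul_assoc, ← mul_assoc, ← hmono, ← h1, h2]
      obtain ⟨h3, h4⟩ := ih α' f' g u hsum hf' hg hu hu0 h2
      exact ⟨((NC.coord k).mul h3).congr (hff.mono fun y h => h.symm), h4⟩
    let P : (Fin n → ℝ) → (Fin n → ℝ) := fun y => y - cE n k y • Pi.single k (1:ℝ)
    have hP : AnalyticAt ℝ P 0 := by
      have : AnalyticAt ℝ (fun y => cE n k y) 0 := (cE n k).analyticAt 0
      exact analyticAt_id.fun_sub (this.fun_smul analyticAt_const)
    have hP0 : P 0 = 0 := by simp [P]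
    have hPk : ∀ y, cE n k (P y) = 0 := by intro y; simp [P]
    have hz : ∀ᶠ y in 𝓝 0, f (P y) * g (P y) = 0 := by
      filter_upwards [(an_tendsto0 hP hP0).eventually h] with y hy
      rw [hy, hmono, hPk]; simp
    rcases germ_domain (an_comp0 hf hP hP0) (an_comp0 hg hP hP0) hz with h1 | h1
    · exact core f g hf hg h h1
    · exact (core g f hg hf (h.mono fun y hy => by rw [mul_comm, hy]) h1).symm

theorem NC.factor {n : ℕ} {f g : (Fin n → ℝ) → ℝ} (h : NC (cE n) (fun y => f y * g y))
    (hf : AnalyticAt ℝ f 0) (hg : AnalyticAt ℝ g 0) : NC (cE n) f ∧ NC (cE n) g := by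
  obtain ⟨α, u, hu, hu0, h⟩ := h
  exact factor_aux _ α f g u rfl hf hg hu hu0 h

theorem NC.factor_prod {n : ℕ} {ι : Type*} (s : Finset ι) {f : ι → (Fin n → ℝ) → ℝ}
    (h : NC (cE n) (fun y => ∏ i ∈ s, f i y)) (hf : ∀ i ∈ s, AnalyticAt ℝ (f i) 0) :
    ∀ i ∈ s, NC (cE n) (f i) := by
  classical
  intro i hi
  refine (NC.factor (g := fun y => ∏ j ∈ s.erase i, f j y) (h.congr ?_) (hf i hi) ?_).1
  · exact Eventually.of_forall fun y => (Finset.mul_prod_erase s (fun j => f j y) hi).symm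
  · exact Finset.analyticAt_fun_prod _ fun j hj => hf j (Finset.mem_of_mem_erase hj)

theorem cmp_half {n : ℕ} (α β : Fin n → ℕ) (a b : (Fin n → ℝ) → ℝ) (ha : ContinuousAt a 0)
    (hb : ContinuousAt b 0) (ha0 : 0 < a 0) (hb0 : 0 < b 0) (k : Fin n) (hk : β k < α k)
    (P : (Fin n → ℝ) → Prop) (hP : ∀ᶠ y in 𝓝 0, P y) :
    ∃ y, P y ∧ (∀ i, 0 < y i) ∧ (∏ i, y i ^ α i) * a y < (∏ i, y i ^ β i) * b y := by
  have h1 : ∀ᶠ y in 𝓝 0, a y < a 0 + 1 := ha.eventually_lt continuousAt_const (by simp)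
  have h2 : ∀ᶠ y in 𝓝 0, b 0 / 2 < b y := continuousAt_const.eventually_lt hb (by simpa using hb0)
  obtain ⟨ε, hε, hball⟩ := Metric.eventually_nhds_iff.1 (hP.and (h1.and h2))
  set δ := ε / 2 with hδ
  have hδ0 : 0 < δ := by positivity
  set Y : ℝ → Fin n → ℝ := fun s => Function.update (fun _ => δ) k s with hY
  set K := ∏ i ∈ Finset.univ.erase k, δ ^ α i with hK
  set K' := ∏ i ∈ Finset.univ.erase k, δ ^ β i with hK'
  have hKp : 0 < K := Finset.prod_pos fun i _ => by positivity
  have hKp' : 0 < K' := Finset.prod_pos fun i _ => by positivity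
  have hmono : ∀ (θ : Fin n → ℕ) s, ∏ i, Y s i ^ θ i
      = s ^ θ k * ∏ i ∈ Finset.univ.erase k, δ ^ θ i := by
    intro θ s
    rw [← Finset.mul_prod_erase _ _ (Finset.mem_univ k)]
    congr 1
    · simp [hY]
    · apply Finset.prod_congr rfl
      intro i hi
      simp [hY, Function.update_of_ne (Finset.ne_of_mem_erase hi)]
  have hlim : Tendsto (fun s : ℝ => s ^ (α k - β k) * K * (a 0 + 1)) (𝓝[>] 0) (𝓝 0) := by
    have : Tendsto (fun s : ℝ => s ^ (α k - β k) * K * (a 0 + 1)) (𝓝 0)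
        (𝓝 ((0:ℝ) ^ (α k - β k) * K * (a 0 + 1))) := by
      apply Continuous.tendsto (f := fun s : ℝ => s ^ (α k - β k) * K * (a 0 + 1))
      fun_prop
    rw [zero_pow (by omega)] at this
    simp only [zero_mul] at this
    exact this.mono_left nhdsWithin_le_nhds
  have hs : ∀ᶠ s in 𝓝[>] (0:ℝ), s ∈ Set.Ioo 0 δ := Ioo_mem_nhdsGT hδ0
  obtain ⟨s, hs1, hs2, hs3⟩ := ((hlim.eventually_lt_const (show 0 < K' * (b 0 / 2) by positivity)).and
    hs).exists
  have hpos : ∀ i, 0 < Y s i := by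
    intro i
    by_cases h : i = k
    · subst h; simpa [hY] using hs2
    · simpa [hY, h] using hδ0
  have hmem : dist (Y s) 0 < ε := by
    rw [dist_pi_lt_iff hε]
    intro i
    have h3 : Y s i ≤ δ := by
      by_cases h : i = k
      · subst h; simpa [hY] using hs3.le
      · simp [hY, h]
    rw [Pi.zero_apply, Real.dist_eq, sub_zero, abs_of_pos (hpos i)]
    linarith
  obtain ⟨hp1, hp2, hp3⟩ := hball hmem
  refine ⟨Y s, hp1, hpos, ?_⟩
  rw [hmono, hmono, ← hK, ← hK']
  have e1 : s ^ α k = s ^ β k * s ^ (α k - β k) := by rw [← pow_add]; congr 1; omega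
  have hsp : 0 < s ^ β k := by positivity
  have hsp' : 0 < s ^ (α k - β k) := by positivity
  calc s ^ α k * K * a (Y s) ≤ s ^ α k * K * (a 0 + 1) := by
        apply mul_le_mul_of_nonneg_left hp2.le; positivity
    _ = s ^ β k * (s ^ (α k - β k) * K * (a 0 + 1)) := by rw [e1]; ring
    _ < s ^ β k * (K' * (b 0 / 2)) := mul_lt_mul_of_pos_left hs1 hsp
    _ = s ^ β k * K' * (b 0 / 2) := by ring
    _ ≤ _ := by apply mul_le_mul_of_nonneg_left hp3.le; positivity

theorem cmp_lemma {n : ℕ} (α β : Fin n → ℕ) (a b : (Fin n → ℝ) → ℝ) (ha : ContinuousAt a 0)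
    (hb : ContinuousAt b 0) (ha0 : 0 < a 0) (hb0 : 0 < b 0)
    (h : (∀ᶠ y in 𝓝 0, (∏ i, y i ^ α i) * a y - (∏ i, y i ^ β i) * b y = 0) ∨
      NC (cE n) (fun y => (∏ i, y i ^ α i) * a y - (∏ i, y i ^ β i) * b y)) :
    α ≤ β ∨ β ≤ α := by
  by_contra hcon
  rw [not_or] at hcon
  obtain ⟨h1, h2⟩ := hcon
  rw [Pi.le_def] at h1 h2
  push Not at h1 h2
  obtain ⟨k, hk⟩ := h1
  obtain ⟨j, hj⟩ := h2
  rcases h with h | ⟨γ, c, hc, hc0, h⟩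
  · obtain ⟨y, hy1, hy2, hy3⟩ := cmp_half α β a b ha hb ha0 hb0 k hk _ h
    linarith
  · rcases lt_or_gt_of_ne hc0 with hc1 | hc1
    · have hc2 : ∀ᶠ y in 𝓝 0, c y < 0 := hc.continuousAt.eventually_lt continuousAt_const hc1
      obtain ⟨y, ⟨hy1, hy0⟩, hy2, hy3⟩ := cmp_half β α b a hb ha hb0 ha0 j hj _ (h.and hc2)
      have : 0 < ∏ i, cE n i y ^ γ i := Finset.prod_pos fun i _ => pow_pos (hy2 i) _
      have := mul_neg_of_pos_of_neg this hy0
      linarith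
    · have hc2 : ∀ᶠ y in 𝓝 0, 0 < c y := continuousAt_const.eventually_lt hc.continuousAt hc1
      obtain ⟨y, ⟨hy1, hy0⟩, hy2, hy3⟩ := cmp_half α β a b ha hb ha0 hb0 k hk _ (h.and hc2)
      have : 0 < ∏ i, cE n i y ^ γ i := Finset.prod_pos fun i _ => pow_pos (hy2 i) _
      have := mul_pos this hy0
      linarith


/-- local monomialization of a germ along an ultrafilter -/
def Unif {ι X κ : Type} [NormedAddCommGroup X] [NormedSpace ℝ X] [Fintype κ] (U : Ultrafilter ι)
    (l : κ → X →L[ℝ] ℝ) (f : X → ℝ) (x : ι → X) : Prop :=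
  ∃ (π : X → X) (y : ι → X), AnalyticAt ℝ π 0 ∧ π 0 = 0 ∧ Tendsto y U (𝓝 0) ∧
    (∀ᶠ k in U, π (y k) = x k) ∧ NC l (fun z => f (π z))

section
variable {ι X κ : Type} [NormedAddCommGroup X] [NormedSpace ℝ X] [Fintype κ] {U : Ultrafilter ι}
  {l : κ → X →L[ℝ] ℝ}

theorem Unif.pullback {f : X → ℝ} {x z : ι → X} {σ : X → X} (hσ : AnalyticAt ℝ σ 0) (h0 : σ 0 = 0)
    (hz : ∀ᶠ k in U, σ (z k) = x k) (h : Unif U l (fun y => f (σ y)) z) : Unif U l f x := by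
  obtain ⟨π, y, hπ, hπ0, hy, hyz, hNC⟩ := h
  refine ⟨fun w => σ (π w), y, an_comp0 hσ hπ hπ0, by simp [hπ0, h0], hy, ?_, hNC⟩
  filter_upwards [hz, hyz] with k h1 h2
  rw [h2, h1]

theorem Unif.congr {f g : X → ℝ} {x : ι → X} (h : Unif U l f x) (hfg : ∀ᶠ z in 𝓝 0, f z = g z) :
    Unif U l g x := by
  obtain ⟨π, y, hπ, hπ0, hy, hyz, hNC⟩ := h
  exact ⟨π, y, hπ, hπ0, hy, hyz, hNC.congr ((an_tendsto0 hπ hπ0).eventually hfg)⟩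

theorem ultra_lim (a : ι → ℝ) (C : ℝ) (h : ∀ᶠ k in U, |a k| ≤ C) : ∃ t, Tendsto a U (𝓝 t) := by
  have hc : IsCompact (Set.Icc (-C) C) := isCompact_Icc
  have : ((U.map a : Ultrafilter ℝ) : Filter ℝ) ≤ 𝓟 (Set.Icc (-C) C) := by
    rw [le_principal_iff]
    exact h.mono fun k hk => abs_le.1 hk
  obtain ⟨t, _, ht⟩ := hc.ultrafilter_le_nhds _ this
  exact ⟨t, ht⟩
end

/-- monomialization statement in dimension `n` -/
def SS {ι : Type} (U : Ultrafilter ι) (n : ℕ) : Prop :=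
  ∀ (f : (Fin n → ℝ) → ℝ) (x : ι → Fin n → ℝ), AnalyticAt ℝ f 0 → (¬ ∀ᶠ y in 𝓝 0, f y = 0) →
    Tendsto x U (𝓝 0) → Unif U (cE n) f x

theorem sign_power {ι : Type} {U : Ultrafilter ι} {n : ℕ} (N : ℕ) (hN : N ≠ 0) (y : ι → Fin n → ℝ)
    (hy : Tendsto y U (𝓝 0)) : ∃ (ε : Fin n → ℝ) (z : ι → Fin n → ℝ), (∀ j, ε j ≠ 0) ∧
      Tendsto z U (𝓝 0) ∧ ∀ᶠ k in U, (fun j => ε j * z k j ^ N) = y k := by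
  have h1 : ∀ j, ∃ ε : ℝ, ε ≠ 0 ∧ ∀ᶠ k in U, ε * |y k j| = y k j := by
    intro j
    rcases U.eventually_or.1 (Eventually.of_forall fun k => le_total 0 (y k j)) with h | h
    · exact ⟨1, one_ne_zero, h.mono fun k hk => by rw [abs_of_nonneg hk, one_mul]⟩
    · exact ⟨-1, by norm_num, h.mono fun k hk => by rw [abs_of_nonpos hk]; ring⟩
  choose ε hε hε' using h1
  refine ⟨ε, fun k j => |y k j| ^ ((N:ℝ)⁻¹), hε, ?_, ?_⟩
  · rw [tendsto_pi_nhds] at hy ⊢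
    intro j
    have h2 := ((hy j).abs).rpow_const (p := (N:ℝ)⁻¹) (Or.inr (by positivity))
    simpa [Real.zero_rpow, hN] using h2
  · have : ∀ᶠ k in U, ∀ j, ε j * |y k j| = y k j := eventually_all.2 hε'
    filter_upwards [this] with k hk
    funext j
    rw [Real.rpow_inv_natCast_pow (abs_nonneg _) hN, hk j]

theorem key_lemma {ι : Type} {U : Ultrafilter ι} {n : ℕ} (hS : SS U n) (d : ℕ)
    (c : ℕ → (Fin n → ℝ) → ℝ) (h : (Fin n → ℝ) → ℝ) (hc : ∀ i, AnalyticAt ℝ (c i) 0)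
    (hh : AnalyticAt ℝ h 0) (hh0 : ¬ ∀ᶠ y in 𝓝 0, h y = 0) (i1 : ℕ) (hi1 : i1 < d)
    (hi1' : ¬ ∀ᶠ y in 𝓝 0, c i1 y = 0) (x : ι → Fin n → ℝ) (hx : Tendsto x U (𝓝 0)) :
    ∃ (σ : (Fin n → ℝ) → (Fin n → ℝ)) (z : ι → Fin n → ℝ) (lam : Fin n → ℕ)
      (g : ℕ → (Fin n → ℝ) → ℝ), AnalyticAt ℝ σ 0 ∧ σ 0 = 0 ∧ Tendsto z U (𝓝 0) ∧
      (∀ᶠ k in U, σ (z k) = x k) ∧ (∀ i < d, AnalyticAt ℝ (g i) 0) ∧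
      (∀ i < d, ∀ᶠ y in 𝓝 0, c i (σ y) = (∏ j, y j ^ lam j) ^ (d - i) * g i y) ∧
      (∃ i < d, g i 0 ≠ 0) ∧ (∀ i < d, (∀ᶠ y in 𝓝 0, c i y = 0) → g i 0 = 0) ∧
      NC (cE n) (fun y => h (σ y)) := by
  classical
  set N := d.factorial with hN
  have hN0 : N ≠ 0 := Nat.factorial_ne_zero d
  set q : ℕ → ℕ := fun i => N / (d - i) with hq
  have hq' : ∀ i < d, (d - i) * q i = N := fun i hi =>
    Nat.mul_div_cancel' (Nat.dvd_factorial (by omega) (by omega))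
  set I := (Finset.range d).filter (fun i => ¬ ∀ᶠ y in 𝓝 0, c i y = 0) with hI
  have hId : ∀ i ∈ I, i < d := fun i hi => by simpa using (Finset.mem_filter.1 hi).1
  have hIn : ∀ i ∈ I, ¬ ∀ᶠ y in 𝓝 0, c i y = 0 := fun i hi => (Finset.mem_filter.1 hi).2
  set D : ℕ × ℕ → (Fin n → ℝ) → ℝ :=
    fun p y => c p.1 y ^ (2 * q p.1) - c p.2 y ^ (2 * q p.2) with hD
  have hDa : ∀ p, AnalyticAt ℝ (D p) 0 := fun p => ((hc _).fun_pow _).fun_sub ((hc _).fun_pow _)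
  set J := (I ×ˢ I).filter (fun p => ¬ ∀ᶠ y in 𝓝 0, D p y = 0) with hJ
  have hJn : ∀ p ∈ J, ¬ ∀ᶠ y in 𝓝 0, D p y = 0 := fun i hi => (Finset.mem_filter.1 hi).2
  have a1 : AnalyticAt ℝ (fun y => ∏ i ∈ I, c i y) 0 := Finset.analyticAt_fun_prod _ fun i _ => hc i
  have a2 : AnalyticAt ℝ (fun y => ∏ p ∈ J, D p y) 0 := Finset.analyticAt_fun_prod _ fun i _ => hDa i
  obtain ⟨π, y, hπ, hπ0, hy, hyx, hNC⟩ := hS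
    (fun y => (h y * ∏ i ∈ I, c i y) * ∏ p ∈ J, D p y) x ((hh.fun_mul a1).fun_mul a2)
    (germ_mul_ne (hh.fun_mul a1) a2 (germ_mul_ne hh a1 hh0
      (germ_prod_ne _ (fun i _ => hc i) hIn)) (germ_prod_ne _ (fun i _ => hDa i) hJn)) hx
  obtain ⟨n1, n2⟩ := NC.factor (f := fun z => h (π z) * ∏ i ∈ I, c i (π z)) hNC
    (an_comp0 (hh.fun_mul a1) hπ hπ0) (an_comp0 (g := fun y => ∏ p ∈ J, D p y) a2 hπ hπ0)
  obtain ⟨n3, n4⟩ := NC.factor n1 (an_comp0 hh hπ hπ0) (an_comp0 (g := fun y => ∏ i ∈ I, c i y) a1 hπ hπ0)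
  have n5 := NC.factor_prod (f := fun i z => c i (π z)) I n4 fun i _ => an_comp0 (hc i) hπ hπ0
  have n6 := NC.factor_prod (f := fun p z => D p (π z)) J n2 fun i _ => an_comp0 (hDa i) hπ hπ0
  have : ∀ i, ∃ (α : Fin n → ℕ) (u : (Fin n → ℝ) → ℝ), i ∈ I → (AnalyticAt ℝ u 0 ∧ u 0 ≠ 0 ∧
      ∀ᶠ y in 𝓝 0, c i (π y) = (∏ j, cE n j y ^ α j) * u y) := by
    intro i
    by_cases hi : i ∈ I
    · obtain ⟨α, u, h⟩ := n5 i hi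
      exact ⟨α, u, fun _ => h⟩
    · exact ⟨0, 0, fun h => absurd h hi⟩
  choose α u hu using this
  have hcmp : ∀ i ∈ I, ∀ j ∈ I, (2 * q i) • α i ≤ (2 * q j) • α j ∨ (2 * q j) • α j ≤ (2 * q i) • α i := by
    intro i hi j hj
    obtain ⟨b1, b2, b3⟩ := hu i hi
    obtain ⟨b1', b2', b3'⟩ := hu j hj
    have key : ∀ᶠ y in 𝓝 0, D (i, j) (π y) =
        (∏ k, y k ^ ((2 * q i) • α i) k) * u i y ^ (2 * q i) -
        (∏ k, y k ^ ((2 * q j) • α j) k) * u j y ^ (2 * q j) := by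
      filter_upwards [b3, b3'] with y h1 h2
      simp only [hD, h1, h2, mul_pow, ← Finset.prod_pow, Pi.smul_apply, smul_eq_mul,
        ContinuousLinearMap.proj_apply, ← pow_mul]
      simp only [mul_comm]
    refine cmp_lemma _ _ (fun y => u i y ^ (2 * q i)) (fun y => u j y ^ (2 * q j))
      (b1.fun_pow _).continuousAt (b1'.fun_pow _).continuousAt ?_ ?_ ?_
    · rw [pow_mul]; positivity
    · rw [pow_mul]; positivity
    · by_cases hg : ∀ᶠ y in 𝓝 0, D (i, j) y = 0
      · left
        filter_upwards [key, (an_tendsto0 hπ hπ0).eventually hg] with y h1 h2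
        rw [← h1, h2]
      · right
        exact (n6 (i, j) (Finset.mem_filter.2 ⟨Finset.mem_product.2 ⟨hi, hj⟩, hg⟩)).congr key
  have hIne : I.Nonempty := ⟨i1, by simp only [hI, Finset.mem_filter, Finset.mem_range]; exact ⟨hi1, hi1'⟩⟩
  obtain ⟨i0, hi0, hmin⟩ := Finset.exists_minimalFor (fun i => (2 * q i) • α i) I hIne
  have hmin' : ∀ i ∈ I, ∀ j, q i0 * α i0 j ≤ q i * α i j := by
    intro i hi j
    have : (2 * q i0) • α i0 ≤ (2 * q i) • α i := by
      rcases hcmp i hi i0 hi0 with h | h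
      · exact hmin hi h
      · exact h
    have := this j
    simp only [Pi.smul_apply, smul_eq_mul, mul_assoc] at this
    omega
  obtain ⟨ε, z, hε, hz, hzy⟩ := sign_power N hN0 y hy
  set θ : (Fin n → ℝ) → (Fin n → ℝ) := fun w j => ε j * w j ^ N with hθ
  have hcoord : ∀ j, NC (cE n) (fun w => cE n j (θ w)) := by
    intro j
    exact (NC.unit (u := fun _ => ε j) analyticAt_const (hε j)).mul ((NC.coord j).pow N)
  have hθa : AnalyticAt ℝ θ 0 := by
    apply AnalyticAt.pi
    intro j
    exact (hcoord j).analytic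
  have hθ0 : θ 0 = 0 := by
    funext j; simp [hθ, hN0]
  refine ⟨fun w => π (θ w), z, fun j => q i0 * α i0 j,
    fun i w => if i ∈ I then (∏ j, ε j ^ α i j) * (∏ j, w j ^ ((d - i) * (q i * α i j - q i0 * α i0 j)))
      * u i (θ w) else 0, an_comp0 hπ hθa hθ0, by simp [hθ0, hπ0], hz, ?_, ?_, ?_, ⟨i0, hId i0 hi0, ?_⟩,
      ?_, ?_⟩
  · filter_upwards [hzy, hyx] with k h1 h2
    rw [← h2, ← h1]
  · intro i hi
    by_cases hiI : i ∈ I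
    · simp only [hiI, if_true]
      obtain ⟨b1, b2, b3⟩ := hu i hiI
      exact (analyticAt_const.fun_mul (an_mono (cE n) _ 0)).fun_mul (an_comp0 b1 hθa hθ0)
    · simp only [hiI, if_false]; exact analyticAt_const
  · intro i hi
    by_cases hiI : i ∈ I
    · simp only [hiI, if_true]
      obtain ⟨b1, b2, b3⟩ := hu i hiI
      filter_upwards [(an_tendsto0 hθa hθ0).eventually b3] with w hw
      rw [hw, ← Finset.prod_pow]
      have : ∏ j, cE n j (θ w) ^ α i j = (∏ j, (w j ^ (q i0 * α i0 j)) ^ (d - i)) *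
          ((∏ j, ε j ^ α i j) * (∏ j, w j ^ ((d - i) * (q i * α i j - q i0 * α i0 j)))) := by
        rw [← Finset.prod_mul_distrib, ← Finset.prod_mul_distrib]
        apply Finset.prod_congr rfl
        intro j _
        simp only [hθ, ContinuousLinearMap.proj_apply, mul_pow, ← pow_mul]
        rw [mul_left_comm, ← pow_add]
        congr 2
        have e1 := hmin' i hiI j
        have e2 := hq' i hi
        obtain ⟨s, hs⟩ := Nat.exists_eq_add_of_le e1
        rw [hs, Nat.add_sub_cancel_left, ← e2, mul_assoc, hs]
        ring
      rw [this]; ring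
    · have : ∀ᶠ y in 𝓝 0, c i y = 0 := by
        by_contra hcon
        exact hiI (by simp only [hI, Finset.mem_filter, Finset.mem_range]; exact ⟨hi, hcon⟩)
      simp only [hiI, if_false, mul_zero]
      exact (an_tendsto0 (an_comp0 hπ hθa hθ0) (by simp [hθ0, hπ0])).eventually this
  · simp only [hi0, if_true, Nat.sub_self, mul_zero, pow_zero, Finset.prod_const_one, mul_one, hθ0]
    exact mul_ne_zero (Finset.prod_ne_zero_iff.2 fun j _ => pow_ne_zero _ (hε j)) (hu i0 hi0).2.1
  · intro i hi hg
    have : i ∉ I := fun h => hIn i h hg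
    simp [this]
  · exact n3.comp hθa hθ0 hcoord


/-- coordinates on the product -/
noncomputable def cP (n : ℕ) : Option (Fin n) → ((Fin n → ℝ) × ℝ) →L[ℝ] ℝ
  | none => ContinuousLinearMap.snd ℝ _ _
  | some i => (ContinuousLinearMap.proj i).comp (ContinuousLinearMap.fst ℝ _ _)

@[simp] theorem cP_none (n : ℕ) (z : (Fin n → ℝ) × ℝ) : cP n none z = z.2 := rfl
@[simp] theorem cP_some (n : ℕ) (i : Fin n) (z : (Fin n → ℝ) × ℝ) : cP n (some i) z = z.1 i := rfl

theorem NCt (n : ℕ) : NC (cP n) (fun z => z.2) := NC.coord (l := cP n) none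
theorem NCz (n : ℕ) (i : Fin n) : NC (cP n) (fun z => z.1 i) := NC.coord (l := cP n) (some i)

theorem mono_split {n : ℕ} (lam : Fin n → ℕ) (k : Fin n) (hk : lam k ≠ 0) :
    ∃ lam' : Fin n → ℕ, (∑ i, lam' i) + 1 = ∑ i, lam i ∧
      ∀ y : Fin n → ℝ, ∏ i, y i ^ lam i = y k * ∏ i, y i ^ lam' i := by
  refine ⟨Function.update lam k (lam k - 1), ?_, fun y => ?_⟩
  · rw [← Finset.add_sum_erase _ _ (Finset.mem_univ k),
      ← Finset.add_sum_erase _ lam (Finset.mem_univ k)]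
    have : ∑ x ∈ Finset.univ.erase k, Function.update lam k (lam k - 1) x
        = ∑ x ∈ Finset.univ.erase k, lam x := by
      apply Finset.sum_congr rfl
      intro i hi
      rw [Function.update_of_ne (Finset.ne_of_mem_erase hi)]
    rw [this, Function.update_self]
    omega
  · rw [← Finset.mul_prod_erase _ _ (Finset.mem_univ k),
        ← Finset.mul_prod_erase _ (fun i => y i ^ Function.update lam k (lam k - 1) i)
          (Finset.mem_univ k), ← mul_assoc]
    congr 1
    · simp only [Function.update_self]
      rw [← pow_succ']; congr 1; omega
    · apply Finset.prod_congr rfl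
      intro i hi
      rw [Function.update_of_ne (Finset.ne_of_mem_erase hi)]

theorem an_rho {n : ℕ} (lam : Fin n → ℕ) (x : Fin n → ℝ) :
    AnalyticAt ℝ (fun y : Fin n → ℝ => ∏ i, y i ^ lam i) x := an_mono (cE n) lam x

theorem lemmaB {ι : Type} {U : Ultrafilter ι} {n : ℕ} (m : ℕ) :
    ∀ (lam : Fin n → ℕ) (w : ι → (Fin n → ℝ) × ℝ), ∑ i, lam i = m → Tendsto w U (𝓝 0) →
    (∀ᶠ k in U, (w k).2 ≠ 0) → Tendsto (fun k => (∏ j, (w k).1 j ^ lam j) / (w k).2) U (𝓝 0) →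
    ∃ (τ : (Fin n → ℝ) × ℝ → (Fin n → ℝ) × ℝ) (w' : ι → (Fin n → ℝ) × ℝ)
      (r : (Fin n → ℝ) × ℝ → ℝ), AnalyticAt ℝ τ 0 ∧ τ 0 = 0 ∧ Tendsto w' U (𝓝 0) ∧
      (∀ᶠ k in U, τ (w' k) = w k) ∧ (∀ j, NC (cP n) (fun z => (τ z).1 j)) ∧
      NC (cP n) (fun z => (τ z).2) ∧ AnalyticAt ℝ r 0 ∧
      (∀ᶠ z in 𝓝 0, ∏ j, (τ z).1 j ^ lam j = (τ z).2 * r z) := by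
  induction m with
  | zero =>
    intro lam w hlam hw hw2 hlim
    exfalso
    have h0 : ∀ i, lam i = 0 := by simpa using hlam
    simp only [h0, pow_zero, Finset.prod_const_one] at hlim
    have h2 : Tendsto (fun k => (w k).2) U (𝓝 0) := (continuous_snd.tendsto 0).comp hw
    have h3 := h2.mul hlim
    have h4 : Tendsto (fun k => (w k).2 * (1 / (w k).2)) U (𝓝 1) := by
      refine tendsto_const_nhds.congr' ?_
      filter_upwards [hw2] with k hk
      field_simp
    have := tendsto_nhds_unique h3 h4
    simp at this
  | succ m ih =>
    intro lam w hlam hw hw2 hlim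
    obtain ⟨k, hk⟩ : ∃ k, lam k ≠ 0 := by
      by_contra hcon
      push Not at hcon
      simp [hcon] at hlam
    obtain ⟨lam', hsum, hmono⟩ := mono_split lam k hk
    have hw1' : Tendsto (fun i => (w i).1) U (𝓝 0) := (continuous_fst.tendsto 0).comp hw
    have hw2' : Tendsto (fun i => (w i).2) U (𝓝 0) := (continuous_snd.tendsto 0).comp hw
    have ha1 : ∀ j, AnalyticAt ℝ (fun z : (Fin n → ℝ) × ℝ => z.1 j) 0 := fun j => (NCz n j).analytic
    have ha2 : AnalyticAt ℝ (fun z : (Fin n → ℝ) × ℝ => z.2) 0 := (NCt n).analytic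
    have haf : AnalyticAt ℝ (fun z : (Fin n → ℝ) × ℝ => z.1) 0 := by fun_prop
    rcases U.eventually_or.1 (Eventually.of_forall fun i => le_or_gt |(w i).2| |(w i).1 k|) with h | h
    · -- t ≤ z_k
      have hzk : ∀ᶠ i in U, (w i).1 k ≠ 0 := by
        filter_upwards [hw2, h] with i h1 h2 h3
        rw [h3, abs_zero] at h2
        exact h1 (abs_eq_zero.1 (le_antisymm h2 (abs_nonneg _)))
      obtain ⟨t0, ht0⟩ := ultra_lim (U := U) (fun i => (w i).2 / (w i).1 k) 1 (by
        filter_upwards [h] with i hi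
        rw [abs_div]
        exact div_le_one_of_le₀ hi (abs_nonneg _))
      set τ1 : (Fin n → ℝ) × ℝ → (Fin n → ℝ) × ℝ := fun z => (z.1, z.1 k * (t0 + z.2)) with hτ1
      have hτa : AnalyticAt ℝ τ1 0 :=
        haf.prod ((ha1 k).fun_mul (analyticAt_const.fun_add ha2))
      have hτ0 : τ1 0 = 0 := by simp [hτ1]
      set w1 : ι → (Fin n → ℝ) × ℝ := fun i => ((w i).1, (w i).2 / (w i).1 k - t0) with hw1
      have hw1t : Tendsto w1 U (𝓝 0) := by
        have := hw1'.prodMk_nhds (ht0.sub_const t0)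
        rw [sub_self] at this
        exact this
      have hτw : ∀ᶠ i in U, τ1 (w1 i) = w i := by
        filter_upwards [hzk] with i hi
        simp only [hτ1, hw1]
        ext j
        · rfl
        · simp only; field_simp; ring
      by_cases ht : t0 = 0
      · subst ht
        obtain ⟨τ, w', r, c1, c2, c3, c4, c5, c6, c7, c8⟩ := ih lam' w1 (by omega) hw1t (by
          filter_upwards [hw2, hzk] with i h1 h2
          simp only [hw1, sub_zero]
          exact div_ne_zero h1 h2) (by
          refine hlim.congr' ?_
          filter_upwards [hw2, hzk] with i h1 h2
          rw [hmono]
          simp only [hw1, sub_zero]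
          field_simp)
        refine ⟨fun z => τ1 (τ z), w', r, an_comp0 hτa c1 c2, by simp [c2, hτ0], c3, ?_, ?_, ?_, c7, ?_⟩
        · filter_upwards [c4, hτw] with i h1 h2
          rw [h1, h2]
        · intro j; exact c5 j
        · simp only [hτ1, zero_add]; exact (c5 k).mul c6
        · filter_upwards [c8] with z hz
          simp only [hτ1, zero_add]
          rw [hmono, hz]; ring
      · refine ⟨τ1, w1, fun z => (∏ j, z.1 j ^ lam' j) * (t0 + z.2)⁻¹, hτa, hτ0, hw1t, hτw, ?_, ?_,
          ?_, ?_⟩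
        · intro j; exact NCz n j
        · exact (NCz n k).mul (NC.unit (analyticAt_const.fun_add ha2) (by simpa using ht))
        · have := (analyticAt_const (v := t0)).fun_add ha2
          exact (an_comp0 (g := fun y : Fin n → ℝ => ∏ i, y i ^ lam' i) (an_rho lam' 0) haf rfl).fun_mul
            (this.fun_inv (by simpa using ht))
        · have : ∀ᶠ z : (Fin n → ℝ) × ℝ in 𝓝 0, t0 + z.2 ≠ 0 :=
            ((analyticAt_const (v := t0)).fun_add ha2).continuousAt.eventually_ne (by simpa using ht)
          filter_upwards [this] with z hz
          simp only [hτ1]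
          rw [hmono]; field_simp
    · -- z_k < t
      obtain ⟨s0, hs0⟩ := ultra_lim (U := U) (fun i => (w i).1 k / (w i).2) 1 (by
        filter_upwards [h] with i hi
        rw [abs_div]
        exact div_le_one_of_le₀ hi.le (abs_nonneg _))
      set τ1 : (Fin n → ℝ) × ℝ → (Fin n → ℝ) × ℝ :=
        fun z => (Function.update z.1 k (z.2 * (s0 + z.1 k)), z.2) with hτ1
      have hNk : NC (cP n) (fun z => z.2 * (s0 + z.1 k)) := by
        by_cases hs : s0 = 0
        · subst hs; simp only [zero_add]; exact (NCt n).mul (NCz n k)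
        · exact (NCt n).mul (NC.unit (analyticAt_const.fun_add (ha1 k)) (by simpa using hs))
      have hNj : ∀ j, NC (cP n) (fun z => (τ1 z).1 j) := by
        intro j
        by_cases hj : j = k
        · subst hj; simpa [hτ1] using hNk
        · simpa [hτ1, hj] using NCz n j
      have hτ1f : AnalyticAt ℝ (fun z => (τ1 z).1) 0 := AnalyticAt.pi fun j => (hNj j).analytic
      have hτa : AnalyticAt ℝ τ1 0 := hτ1f.prod ha2
      have hτ0 : τ1 0 = 0 := by
        ext j
        · by_cases hj : j = k
          · subst hj; simp [hτ1]
          · simp [hτ1, hj]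
        · simp [hτ1]
      set w1 : ι → (Fin n → ℝ) × ℝ :=
        fun i => (Function.update (w i).1 k ((w i).1 k / (w i).2 - s0), (w i).2) with hw1
      refine ⟨τ1, w1, fun z => (s0 + z.1 k) * ∏ j, (τ1 z).1 j ^ lam' j, hτa, hτ0, ?_, ?_, hNj, NCt n,
        ?_, ?_⟩
      · have h1 : Tendsto (fun i => Function.update (w i).1 k ((w i).1 k / (w i).2 - s0)) U (𝓝 0) := by
          rw [tendsto_pi_nhds] at hw1' ⊢
          intro j
          by_cases hj : j = k
          · subst hj
            simpa using hs0.sub_const s0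
          · simpa [hj] using hw1' j
        exact h1.prodMk_nhds hw2'
      · filter_upwards [hw2] with i hi
        simp only [hτ1, hw1]
        ext j
        · by_cases hj : j = k
          · subst hj
            simp only [Function.update_self]
            field_simp; ring
          · simp [hj]
        · rfl
      · exact (analyticAt_const.fun_add (ha1 k)).fun_mul
          (an_comp0 (g := fun y : Fin n → ℝ => ∏ i, y i ^ lam' i) (an_rho lam' 0) hτ1f (by rw [hτ0]; rfl))
      · refine Eventually.of_forall fun z => ?_
        rw [hmono]
        simp only [hτ1, Function.update_self]
        ring

theorem poly_order (d : ℕ) (hd : 1 ≤ d) (g : ℕ → ℝ) (u0 t0 : ℝ) (hu0 : u0 ≠ 0) (hg : g (d - 1) = 0)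
    (i0 : ℕ) (hi0 : i0 < d) (hgi : g i0 ≠ 0) :
    ∃ m < d, ∃ v : ℝ → ℝ, AnalyticAt ℝ v 0 ∧ v 0 ≠ 0 ∧ ∀ T : ℝ,
      (∑ i ∈ Finset.range d, g i * (t0 + T) ^ i) + (t0 + T) ^ d * u0 = T ^ m * v T := by
  open Polynomial in
  set P : ℝ[X] := (∑ i ∈ Finset.range d, C (g i) * X ^ i) + C u0 * X ^ d with hP
  have hcoef : ∀ j, P.coeff j = (if j < d then g j else 0) + if j = d then u0 else 0 := by
    intro j
    simp only [hP, coeff_add, finsetSum_coeff, coeff_C_mul_X_pow, Finset.sum_ite_eq,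
      Finset.mem_range]
  have hPd : P.coeff d = u0 := by rw [hcoef]; simp
  have hP0 : P ≠ 0 := by
    intro h; rw [h] at hPd; exact hu0 (by simpa using hPd.symm)
  have heval : ∀ T, P.eval (t0 + T) = (∑ i ∈ Finset.range d, g i * (t0 + T) ^ i) + (t0 + T) ^ d * u0 := by
    intro T
    simp only [hP, eval_add, eval_finsetSum, eval_mul, eval_C, eval_pow, eval_X]
    ring
  have hdeg : P.natDegree ≤ d := by
    rw [natDegree_le_iff_coeff_eq_zero]
    intro N hN
    rw [hcoef, if_neg (by omega), if_neg (by omega), add_zero]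
  obtain ⟨Q, hQ, hQ0⟩ := exists_eq_pow_rootMultiplicity_mul_and_not_dvd P hP0 t0
  refine ⟨P.rootMultiplicity t0, ?_, fun T => Q.eval (t0 + T), ?_, ?_, ?_⟩
  · by_contra hcon
    push Not at hcon
    have hQne : Q ≠ 0 := by rintro rfl; exact hQ0 (dvd_zero _)
    have hd1 : P.natDegree = P.rootMultiplicity t0 + Q.natDegree := by
      conv_lhs => rw [hQ]
      rw [natDegree_mul (pow_ne_zero _ (X_sub_C_ne_zero t0)) hQne, natDegree_pow, natDegree_X_sub_C,
        mul_one]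
    have hm : P.rootMultiplicity t0 = d := by omega
    have hq : Q.natDegree = 0 := by omega
    rw [natDegree_eq_zero] at hq
    obtain ⟨a, rfl⟩ := hq
    rw [hm] at hQ
    have hc : ∀ j, P.coeff j = (-t0) ^ (d - j) * (d.choose j) * a := by
      intro j
      rw [hQ, sub_eq_add_neg, ← C_neg, mul_comm, coeff_C_mul, coeff_X_add_C_pow]
      ring
    have ha : a ≠ 0 := by
      rintro rfl; exact hQne (by simp)
    have h1 := hc (d - 1)
    rw [hcoef, if_pos (by omega), if_neg (by omega), hg] at h1
    have e1 : d - (d - 1) = 1 := by omega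
    have e2 : d.choose (d - 1) = d := by
      rw [← Nat.choose_symm (by omega : d - 1 ≤ d), e1, Nat.choose_one_right]
    rw [e1, e2, pow_one] at h1
    have hd' : (d:ℝ) ≠ 0 := by positivity
    have ht : t0 = 0 := by
      have : -t0 = 0 := by
        by_contra h
        exact mul_ne_zero (mul_ne_zero h hd') ha (by simpa using h1.symm)
      simpa using this
    have h2 := hc i0
    rw [hcoef, if_pos hi0, if_neg (by omega), ht, neg_zero, zero_pow (by omega)] at h2
    simp at h2
    exact hgi h2
  · have : (fun T : ℝ => Q.eval (t0 + T)) = fun T => (Q.comp (C t0 + X)).eval T := by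
      funext T; simp
    rw [this]
    have h5 := AnalyticAt.aeval_polynomial (𝕜 := ℝ) (f := fun T : ℝ => T) (z := (0:ℝ)) analyticAt_id
      (Q.comp (C t0 + X))
    simpa using h5
  · rw [dvd_iff_isRoot] at hQ0
    simpa [IsRoot] using hQ0
  · intro T
    rw [← heval]
    conv_lhs => rw [hQ]
    simp


theorem lift_pull {ι : Type} {U : Ultrafilter ι} {n : ℕ} {π : (Fin n → ℝ) → (Fin n → ℝ)}
    (hπ : AnalyticAt ℝ π 0) (hπ0 : π 0 = 0) :
    AnalyticAt ℝ (fun z : (Fin n → ℝ) × ℝ => (π z.1, z.2)) 0 ∧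
      (fun z : (Fin n → ℝ) × ℝ => (π z.1, z.2)) 0 = 0 := by
  refine ⟨?_, by simp [hπ0]⟩
  have haf : AnalyticAt ℝ (fun z : (Fin n → ℝ) × ℝ => z.1) 0 := by fun_prop
  exact (an_comp0 hπ haf rfl).prod (NCt n).analytic

/-- direct case: power of `t` times unit times `h` -/
theorem unif_direct {ι : Type} {U : Ultrafilter ι} {n : ℕ} (hS : SS U n) (d : ℕ)
    (u : (Fin n → ℝ) × ℝ → ℝ) (hu : AnalyticAt ℝ u 0) (hu0 : u 0 ≠ 0) (h : (Fin n → ℝ) → ℝ)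
    (hh : AnalyticAt ℝ h 0) (hh0 : ¬ ∀ᶠ y in 𝓝 0, h y = 0) (x : ι → (Fin n → ℝ) × ℝ)
    (hx : Tendsto x U (𝓝 0)) : Unif U (cP n) (fun z => z.2 ^ d * u z * h z.1) x := by
  have hx1 : Tendsto (fun i => (x i).1) U (𝓝 0) := (continuous_fst.tendsto 0).comp hx
  have hx2 : Tendsto (fun i => (x i).2) U (𝓝 0) := (continuous_snd.tendsto 0).comp hx
  have haf : AnalyticAt ℝ (fun z : (Fin n → ℝ) × ℝ => z.1) 0 := by fun_prop
  obtain ⟨π, y, hπ, hπ0, hy, hyx, hNC⟩ := hS h (fun i => (x i).1) hh hh0 hx1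
  obtain ⟨l1, l2⟩ := lift_pull (U := U) hπ hπ0
  refine ⟨fun z => (π z.1, z.2), fun i => (y i, (x i).2), l1, l2, hy.prodMk_nhds hx2, ?_, ?_⟩
  · filter_upwards [hyx] with k hk
    rw [hk]
  · refine (((NCt n).pow d).mul (NC.unit (an_comp0 hu l1 l2) ?_)).mul
      (hNC.comp (τ := fun z : (Fin n → ℝ) × ℝ => z.1) haf rfl (fun j => NCz n j))
    rw [show ((0 : (Fin n → ℝ) × ℝ).1) = 0 from rfl, hπ0]
    exact hu0

/-- the statement proved by induction on the order `d` -/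
def TT {ι : Type} (U : Ultrafilter ι) (n d : ℕ) : Prop :=
  ∀ (F : (Fin n → ℝ) × ℝ → ℝ) (h : (Fin n → ℝ) → ℝ) (v : ℝ → ℝ) (x : ι → (Fin n → ℝ) × ℝ),
    AnalyticAt ℝ F 0 → AnalyticAt ℝ v 0 → v 0 ≠ 0 → (∀ᶠ t in 𝓝 0, F (0, t) = t ^ d * v t) →
    AnalyticAt ℝ h 0 → (¬ ∀ᶠ y in 𝓝 0, h y = 0) → Tendsto x U (𝓝 0) →
    Unif U (cP n) (fun z => F z * h z.1) x

/-- main step: after Tschirnhaus and the key lemma -/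
theorem main_step {ι : Type} {U : Ultrafilter ι} {n : ℕ} (d : ℕ) (hd : 1 ≤ d)
    (ih : ∀ m < d, TT U n m) (lam : Fin n → ℕ) (g : ℕ → (Fin n → ℝ) → ℝ)
    (hg : ∀ i < d, AnalyticAt ℝ (g i) 0) (u : (Fin n → ℝ) × ℝ → ℝ) (hu : AnalyticAt ℝ u 0)
    (hu0 : u 0 ≠ 0) (h : (Fin n → ℝ) → ℝ) (hh : NC (cE n) h) (i0 : ℕ) (hi0 : i0 < d)
    (hgi : g i0 0 ≠ 0) (hgd : g (d - 1) 0 = 0) (hrho : ∏ j, (0 : Fin n → ℝ) j ^ lam j = 0)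
    (w : ι → (Fin n → ℝ) × ℝ) (hw : Tendsto w U (𝓝 0)) :
    Unif U (cP n) (fun z => ((∑ i ∈ Finset.range d, (∏ j, z.1 j ^ lam j) ^ (d - i) * g i z.1 * z.2 ^ i)
      + z.2 ^ d * u z) * h z.1) w := by
  set ρ : (Fin n → ℝ) → ℝ := fun y => ∏ j, y j ^ lam j with hρ
  have hρa : AnalyticAt ℝ ρ 0 := an_rho lam 0
  have hρNC : NC (cE n) ρ := NC.mono (l := cE n) lam
  have hρ0 : ρ 0 = 0 := hrho
  have hw1 : Tendsto (fun i => (w i).1) U (𝓝 0) := (continuous_fst.tendsto 0).comp hw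
  have hw2 : Tendsto (fun i => (w i).2) U (𝓝 0) := (continuous_snd.tendsto 0).comp hw
  have haf : AnalyticAt ℝ (fun z : (Fin n → ℝ) × ℝ => z.1) 0 := by fun_prop
  have has : AnalyticAt ℝ (fun z : (Fin n → ℝ) × ℝ => z.2) 0 := by fun_prop
  by_cases hcase : ∃ C : ℝ, ∀ᶠ k in U, |(w k).2| ≤ C * |ρ (w k).1|
  · obtain ⟨C, hC⟩ := hcase
    obtain ⟨t0, ht0⟩ := ultra_lim (U := U) (fun i => (w i).2 / ρ (w i).1) |C| (by
      filter_upwards [hC] with i hi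
      rw [abs_div]
      by_cases hz : ρ (w i).1 = 0
      · simp [hz]
      · rw [div_le_iff₀ (abs_pos.2 hz)]
        exact hi.trans (mul_le_mul_of_nonneg_right (le_abs_self C) (abs_nonneg _)))
    set τ : (Fin n → ℝ) × ℝ → (Fin n → ℝ) × ℝ := fun z => (z.1, ρ z.1 * (t0 + z.2)) with hτ
    have hρf : AnalyticAt ℝ (fun z : (Fin n → ℝ) × ℝ => ρ z.1) 0 := an_comp0 hρa haf rfl
    have hτa : AnalyticAt ℝ τ 0 := haf.prod (hρf.fun_mul (analyticAt_const.fun_add has))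
    have hτ0 : τ 0 = 0 := by simp [hτ, hρ0]
    obtain ⟨m, hm, v, hv, hv0, hP⟩ := poly_order d hd (fun i => g i 0) (u 0) t0 hu0 hgd i0 hi0 hgi
    have hT := ih m hm (fun z => (∑ i ∈ Finset.range d, g i z.1 * (t0 + z.2) ^ i)
        + (t0 + z.2) ^ d * u (τ z)) (fun y => ρ y ^ d * h y) v
        (fun i => ((w i).1, (w i).2 / ρ (w i).1 - t0)) ?_ hv hv0 ?_ ?_ ?_ ?_
    · refine Unif.pullback hτa hτ0 ?_ (hT.congr ?_)
      · filter_upwards [hC] with i hi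
        simp only [hτ]
        ext j
        · rfl
        · simp only
          by_cases hz : ρ (w i).1 = 0
          · rw [hz] at hi ⊢
            simp at hi
            simp [hi]
          · field_simp; ring
      · refine Eventually.of_forall fun z => ?_
        simp only [hτ]
        rw [← mul_assoc, add_mul, add_mul, add_mul, Finset.sum_mul, Finset.sum_mul, Finset.sum_mul]
        congr 1
        · apply Finset.sum_congr rfl
          intro i hi
          have : ρ z.1 ^ d = ρ z.1 ^ (d - i) * ρ z.1 ^ i := by
            rw [← pow_add]; congr 1; have := Finset.mem_range.1 hi; omega
          change g i z.1 * (t0 + z.2) ^ i * ρ z.1 ^ d * h z.1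
            = ρ z.1 ^ (d - i) * g i z.1 * (ρ z.1 * (t0 + z.2)) ^ i * h z.1
          rw [this, mul_pow]; ring
        · rw [mul_pow]; ring
    · refine (Finset.analyticAt_fun_sum _ fun i hi => ?_).fun_add ?_
      · exact (an_comp0 (hg i (Finset.mem_range.1 hi)) haf rfl).fun_mul
          ((analyticAt_const.fun_add has).fun_pow _)
      · exact ((analyticAt_const.fun_add has).fun_pow _).fun_mul (an_comp0 hu hτa hτ0)
    · refine Eventually.of_forall fun T => ?_
      rw [← hP T]
      have : τ (0, T) = 0 := by simp [hτ, hρ0]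
      rw [this]
    · exact (hρa.fun_pow d).fun_mul hh.analytic
    · exact germ_mul_ne (hρa.fun_pow d) hh.analytic (germ_pow_ne (hρNC.ne (cE_ne n)) d)
        (hh.ne (cE_ne n))
    · have := hw1.prodMk_nhds (ht0.sub_const t0)
      rw [sub_self] at this
      exact this
  · push Not at hcase
    have hlt : ∀ C : ℝ, ∀ᶠ k in U, C * |ρ (w k).1| < |(w k).2| := by
      intro C
      exact hcase C
    have hne : ∀ᶠ k in U, (w k).2 ≠ 0 := by
      filter_upwards [hlt 0] with k hk
      rw [zero_mul] at hk
      exact abs_pos.1 hk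
    have hlim : Tendsto (fun k => ρ (w k).1 / (w k).2) U (𝓝 0) := by
      rw [Metric.tendsto_nhds]
      intro ε hε
      filter_upwards [hlt ε⁻¹, hne] with k h1 h2
      rw [Real.dist_eq, sub_zero, abs_div, div_lt_iff₀ (abs_pos.2 h2)]
      rwa [inv_mul_lt_iff₀ hε] at h1
    obtain ⟨τ, w', r, c1, c2, c3, c4, c5, c6, c7, c8⟩ := lemmaB _ lam w rfl hw hne hlim
    have hr0 : r 0 = 0 := by
      have h1 : Tendsto (fun k => r (w' k)) U (𝓝 (r 0)) := c7.continuousAt.tendsto.comp c3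
      refine tendsto_nhds_unique (h1.congr' ?_) hlim
      filter_upwards [c3.eventually c8, c4, hne] with k h1 h2 h3
      rw [h2] at h1
      rw [eq_div_iff h3, mul_comm]
      exact h1.symm
    have cf : AnalyticAt ℝ (fun z => (τ z).1) 0 := an_fst c1
    have cf0 : (τ 0).1 = 0 := by rw [c2]; rfl
    refine ⟨τ, w', c1, c2, c3, c4, ?_⟩
    have hU : AnalyticAt ℝ (fun z => (∑ i ∈ Finset.range d, g i (τ z).1 * r z ^ (d - i)) + u (τ z)) 0 := by
      refine (Finset.analyticAt_fun_sum _ fun i hi => ?_).fun_add (an_comp0 hu c1 c2)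
      exact (an_comp0 (hg i (Finset.mem_range.1 hi)) cf cf0).fun_mul (c7.fun_pow _)
    have hN := ((c6.pow d).mul (NC.unit hU (by
      rw [Finset.sum_eq_zero, c2, zero_add]
      · exact hu0
      · intro i hi
        have := Finset.mem_range.1 hi
        rw [hr0, zero_pow (by omega), mul_zero]))).mul (hh.comp cf cf0 c5)
    refine hN.congr ?_
    filter_upwards [c8] with z hz
    congr 1
    rw [mul_add, Finset.mul_sum]
    congr 1
    apply Finset.sum_congr rfl
    intro i hi
    rw [hz]
    have : (τ z).2 ^ d = (τ z).2 ^ (d - i) * (τ z).2 ^ i := by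
      rw [← pow_add]; congr 1; have := Finset.mem_range.1 hi; omega
    rw [this, mul_pow]; ring

theorem TT_all {ι : Type} {U : Ultrafilter ι} {n : ℕ} (hS : SS U n) (d : ℕ) : TT U n d := by
  induction d using Nat.strong_induction_on with
  | _ d ih =>
    intro F h v x hF hv hv0 hFv hh hh0 hx
    rcases Nat.eq_zero_or_pos d with rfl | hd
    · have h0 := hFv.self_of_nhds
      have := unif_direct hS 0 F hF (by rw [Prod.zero_eq_mk, h0]; simpa using hv0) h hh hh0 x hx
      simpa using this
    · obtain ⟨φ, c, u, t1, t2, t3, t4, t5, t6, t7, t8⟩ := tschirnhaus F hF d hd v hv hv0 hFv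
      have hx1 : Tendsto (fun i => (x i).1) U (𝓝 0) := (continuous_fst.tendsto 0).comp hx
      have hx2 : Tendsto (fun i => (x i).2) U (𝓝 0) := (continuous_snd.tendsto 0).comp hx
      have haf : AnalyticAt ℝ (fun z : (Fin n → ℝ) × ℝ => z.1) 0 := by fun_prop
      have has : AnalyticAt ℝ (fun z : (Fin n → ℝ) × ℝ => z.2) 0 := by fun_prop
      have hφx : Tendsto (fun i => (x i).2 - φ (x i).1) U (𝓝 0) := by
        have := hx2.sub ((an_tendsto0 t1 t2).comp hx1)
        rw [sub_zero] at this
        exact this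
      refine Unif.pullback (σ := fun z => (z.1, z.2 + φ z.1))
        (z := fun i => ((x i).1, (x i).2 - φ (x i).1))
        (haf.prod (has.fun_add (an_comp0 t1 haf rfl))) (by simp [t2])
        (Eventually.of_forall fun k => by simp) ?_
      have hx' : Tendsto (fun i => ((x i).1, (x i).2 - φ (x i).1)) U (𝓝 0) := hx1.prodMk_nhds hφx
      by_cases hall : ∀ i < d, ∀ᶠ y in 𝓝 0, c i y = 0
      · refine (unif_direct hS d u t5 t6 h hh hh0 _ hx').congr ?_
        have : ∀ᶠ y in 𝓝 (0 : Fin n → ℝ), ∀ i ∈ Finset.range d, c i y = 0 :=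
          (Finset.eventually_all _).2 fun i hi => hall i (Finset.mem_range.1 hi)
        filter_upwards [t8, (an_tendsto0 haf rfl).eventually this] with z h1 h2
        rw [h1, Finset.sum_eq_zero fun i hi => by rw [h2 i hi, zero_mul], zero_add]
      · push Not at hall
        obtain ⟨i1, hi1, hi1'⟩ := hall
        rw [← Filter.not_eventually] at hi1'
        obtain ⟨σ, z, lam, g, k1, k2, k3, k4, k5, k6, ⟨i0, hi0, hgi⟩, k8, k9⟩ :=
          key_lemma hS d c h t3 hh hh0 i1 hi1 hi1' (fun i => (x i).1) hx1
        obtain ⟨l1, l2⟩ := lift_pull (U := U) k1 k2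
        have hrho : ∏ j, (0 : Fin n → ℝ) j ^ lam j = 0 := by
          have h1 := (k6 i0 hi0).self_of_nhds
          rw [k2, t4 i0 hi0] at h1
          have := (mul_eq_zero.1 h1.symm).resolve_right hgi
          exact eq_zero_of_pow_eq_zero this
        have hms := main_step d hd ih lam g k5 (fun z => u (σ z.1, z.2)) (an_comp0 t5 l1 l2)
          (by rw [show ((0 : (Fin n → ℝ) × ℝ).1) = 0 from rfl, k2]; exact t6) (fun y => h (σ y)) k9 i0 hi0 hgi
          (k8 (d - 1) (by omega) t7) hrho (fun i => (z i, (x i).2 - φ (x i).1)) (k3.prodMk_nhds hφx)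
        refine Unif.pullback (σ := fun z => (σ z.1, z.2)) (z := fun i => (z i, (x i).2 - φ (x i).1))
          l1 l2 ?_ (hms.congr ?_)
        · filter_upwards [k4] with k hk
          rw [hk]
        · have : ∀ᶠ y in 𝓝 (0 : Fin n → ℝ), ∀ i ∈ Finset.range d,
              c i (σ y) = (∏ j, y j ^ lam j) ^ (d - i) * g i y :=
            (Finset.eventually_all _).2 fun i hi => k6 i (Finset.mem_range.1 hi)
          filter_upwards [(an_tendsto0 l1 l2).eventually t8, (an_tendsto0 haf rfl).eventually this]
            with z h1 h2
          rw [h1]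
          congr 2
          apply Finset.sum_congr rfl
          intro i hi
          rw [h2 i hi]


theorem exists_line {X : Type*} [NormedAddCommGroup X] [NormedSpace ℝ X] {f : X → ℝ}
    (hf : AnalyticAt ℝ f 0) (hne : ¬ ∀ᶠ y in 𝓝 0, f y = 0) :
    ∃ v : X, ¬ ∀ᶠ t : ℝ in 𝓝 0, f (t • v) = 0 := by
  by_contra hcon
  push Not at hcon
  apply hne
  obtain ⟨ε, hε, hball⟩ := Metric.eventually_nhds_iff_ball.1 hf.eventually_analyticAt
  filter_upwards [Metric.ball_mem_nhds (0:X) hε] with v hv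
  have hconv : Convex ℝ ((fun t : ℝ => t • v) ⁻¹' Metric.ball (0:X) ε) :=
    (convex_ball (0:X) ε).is_linear_preimage (IsLinearMap.mk (fun a b => add_smul a b v)
      (fun a b => by simp [mul_smul]))
  have han : AnalyticOnNhd ℝ (fun t : ℝ => f (t • v)) ((fun t : ℝ => t • v) ⁻¹' Metric.ball (0:X) ε) := by
    intro t ht
    exact AnalyticAt.fun_comp (g := f) (f := fun t : ℝ => t • v) (hball _ ht)
      (analyticAt_id.fun_smul analyticAt_const)
  have := han.eqOn_zero_of_preconnected_of_eventuallyEq_zero hconv.isPreconnected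
    (z₀ := 0) (by simpa using hε) (hcon v) (x := 1) (by simpa using hv)
  simpa using this

theorem SS_succ {ι : Type} {U : Ultrafilter ι} {n : ℕ} (hS : SS U n) : SS U (n + 1) := by
  intro f x hf hne hx
  by_cases hf0 : f 0 = 0
  swap
  · exact ⟨fun z => z, x, analyticAt_id, rfl, hx, by simp, NC.unit hf hf0⟩
  obtain ⟨v, hv⟩ := exists_line hf hne
  have hv0 : v ≠ 0 := by
    rintro rfl
    simp [hf0] at hv
  obtain ⟨k, hk⟩ : ∃ k, v k ≠ 0 := by
    by_contra hcon
    push Not at hcon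
    exact hv0 (funext hcon)
  set A : (Fin n → ℝ) × ℝ → (Fin (n+1) → ℝ) :=
    fun z => z.2 • v + Fin.insertNth (α := fun _ => ℝ) k (0:ℝ) z.1 with hA
  have hAa : AnalyticAt ℝ A 0 := by
    apply AnalyticAt.pi
    intro j
    simp only [hA, Pi.add_apply, Pi.smul_apply, smul_eq_mul]
    refine ((NCt n).analytic.fun_mul analyticAt_const).fun_add ?_
    rcases Fin.eq_self_or_eq_succAbove k j with rfl | ⟨i, rfl⟩
    · simp only [Fin.insertNth_apply_same]; exact analyticAt_const
    · simp only [Fin.insertNth_apply_succAbove]; exact (NCz n i).analytic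
  have hA0 : A 0 = 0 := by
    funext j
    simp only [hA, Pi.add_apply, Pi.smul_apply, smul_eq_mul]
    rcases Fin.eq_self_or_eq_succAbove k j with rfl | ⟨i, rfl⟩ <;> simp
  have hx' : ∀ j, Tendsto (fun i => x i j) U (𝓝 0) := by
    intro j
    exact (tendsto_pi_nhds.1 hx) j
  set w : ι → (Fin n → ℝ) × ℝ := fun i =>
    (fun j => x i (k.succAbove j) - (x i k / v k) * v (k.succAbove j), x i k / v k) with hw
  have hwt2 : Tendsto (fun i => x i k / v k) U (𝓝 0) := by
    simpa using (hx' k).div_const (v k)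
  have hwt : Tendsto w U (𝓝 0) := by
    refine Tendsto.prodMk_nhds (x := (0 : Fin n → ℝ)) (y := (0:ℝ)) ?_ hwt2
    rw [tendsto_pi_nhds]
    intro j
    simpa using (hx' (k.succAbove j)).sub (hwt2.mul_const (v (k.succAbove j)))
  have hAw : ∀ i, A (w i) = x i := by
    intro i
    funext j
    simp only [hA, hw, Pi.add_apply, Pi.smul_apply, smul_eq_mul]
    rcases Fin.eq_self_or_eq_succAbove k j with rfl | ⟨i, rfl⟩
    · simp only [Fin.insertNth_apply_same]; field_simp; simp
    · simp only [Fin.insertNth_apply_succAbove]; ring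
  have hline : AnalyticAt ℝ (fun t : ℝ => f (t • v)) 0 :=
    AnalyticAt.fun_comp (g := f) (f := fun t : ℝ => t • v) (by simpa using hf)
      (analyticAt_id.fun_smul analyticAt_const)
  have hfin : analyticOrderAt (fun t : ℝ => f (t • v)) 0 ≠ ⊤ := by
    rw [Ne, analyticOrderAt_eq_top]; exact hv
  obtain ⟨d, hd⟩ := ENat.ne_top_iff_exists.1 hfin
  obtain ⟨v', h1, h2, h3⟩ := (hline.analyticOrderAt_eq_natCast).1 hd.symm
  have hT := TT_all hS d (fun z => f (A z)) (fun _ => 1) v' w (an_comp0 hf hAa hA0) h1 h2 (by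
    filter_upwards [h3] with t ht
    have : A (0, t) = t • v := by
      funext j
      simp only [hA, Pi.add_apply, Pi.smul_apply, smul_eq_mul]
      rcases Fin.eq_self_or_eq_succAbove k j with rfl | ⟨i, rfl⟩ <;> simp
    rw [this, ht]; simp) analyticAt_const (fun h => one_ne_zero h.self_of_nhds) hwt
  obtain ⟨π, y, hπ, hπ0, hy, hyx, hNC⟩ := hT
  set M : (Fin (n+1) → ℝ) → (Fin n → ℝ) × ℝ := fun z => (fun j => z j.succ, z 0) with hM
  have hco : ∀ j, AnalyticAt ℝ (fun z : Fin (n+1) → ℝ => z j) 0 := fun j => (cE (n+1) j).analyticAt 0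
  have hMa : AnalyticAt ℝ M 0 := (AnalyticAt.pi fun j : Fin n => hco j.succ).prod (hco 0)
  have hM0 : M 0 = 0 := rfl
  refine ⟨fun z => A (π (M z)), fun i => Fin.cons (y i).2 (y i).1,
    an_comp0 hAa (an_comp0 hπ hMa hM0) (by rw [hM0, hπ0]), by change A (π (M 0)) = 0; rw [hM0, hπ0, hA0], ?_, ?_, ?_⟩
  · rw [tendsto_pi_nhds]
    intro j
    refine Fin.cases ?_ (fun j => ?_) j
    · exact (continuous_snd.tendsto 0).comp hy
    · exact (tendsto_pi_nhds.1 ((continuous_fst.tendsto 0).comp hy)) j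
  · filter_upwards [hyx] with i hi
    have : M (Fin.cons (y i).2 (y i).1) = y i := by
      simp [hM]
    rw [this, hi, hAw]
  · have := hNC.comp (m := cE (n+1)) hMa hM0 (fun o => by
      rcases o with _ | j
      · exact NC.coord (l := cE (n+1)) 0
      · exact NC.coord (l := cE (n+1)) j.succ)
    simpa using this

theorem SS_all {ι : Type} (U : Ultrafilter ι) (n : ℕ) : SS U n := by
  induction n with
  | zero =>
    intro f x hf hne hx
    have : f 0 ≠ 0 := by
      intro h
      apply hne
      refine Eventually.of_forall fun y => ?_
      rw [Subsingleton.elim y 0, h]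
    exact ⟨fun z => z, x, analyticAt_id, rfl, hx, by simp, NC.unit hf this⟩
  | succ n ih => exact SS_succ ih


theorem coord_est {n : ℕ} {f : (Fin n → ℝ) → ℝ} {π : (Fin n → ℝ) → (Fin n → ℝ)}
    (hf : AnalyticAt ℝ f 0) (hπ : AnalyticAt ℝ π 0) (hπ0 : π 0 = 0) (α : Fin n → ℕ)
    (u : (Fin n → ℝ) → ℝ) (hu : AnalyticAt ℝ u 0) (hu0 : u 0 ≠ 0)
    (h : ∀ᶠ y in 𝓝 0, f (π y) = (∏ j, y j ^ α j) * u y) (i : Fin n) (hi : α i ≠ 0) :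
    ∃ M : ℝ, 0 < M ∧ ∀ᶠ y in 𝓝 0, |f (π y)| ≤ M * (|y i| * ‖fderiv ℝ f (π y)‖) := by
  set e : Fin n → ℝ := Pi.single i 1 with he
  -- continuity data
  set B : (Fin n → ℝ) → ℝ := fun y => α i * u y + y i * fderiv ℝ u y e with hB
  have hcu : ContinuousAt u 0 := hu.continuousAt
  have hcdu : ContinuousAt (fderiv ℝ u) 0 := hu.fderiv.continuousAt
  have hcdπ : ContinuousAt (fderiv ℝ π) 0 := hπ.fderiv.continuousAt
  have hcB : ContinuousAt B 0 := by
    refine (continuousAt_const.mul hcu).add ?_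
    exact (continuous_apply i).continuousAt.mul (hcdu.clm_apply continuousAt_const)
  have hB0 : B 0 = α i * u 0 := by simp [hB]
  have hα : (1:ℝ) ≤ α i := by exact_mod_cast Nat.one_le_iff_ne_zero.2 hi
  have hB0' : |u 0| ≤ |B 0| := by
    rw [hB0, abs_mul, Nat.abs_cast]
    nlinarith [abs_nonneg (u 0)]
  have hup : 0 < |u 0| := abs_pos.2 hu0
  have e1 : ∀ᶠ y in 𝓝 0, |u y| < 2 * |u 0| :=
    hcu.abs.eventually_lt continuousAt_const (by linarith)
  have e2 : ∀ᶠ y in 𝓝 0, |u 0| / 2 < |B y| :=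
    continuousAt_const.eventually_lt hcB.abs (by linarith)
  set M1 := ‖fderiv ℝ π 0 e‖ + 1 with hM1
  have e3 : ∀ᶠ y in 𝓝 0, ‖fderiv ℝ π y e‖ < M1 :=
    ((hcdπ.clm_apply continuousAt_const).norm).eventually_lt continuousAt_const (by simp [hM1])
  have e4 : ∀ᶠ y in 𝓝 0, DifferentiableAt ℝ f (π y) :=
    (an_tendsto0 hπ hπ0).eventually (hf.eventually_analyticAt.mono fun y h => h.differentiableAt)
  have e5 : ∀ᶠ y in 𝓝 0, DifferentiableAt ℝ π y :=
    hπ.eventually_analyticAt.mono fun y h => h.differentiableAt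
  have e6 : ∀ᶠ y in 𝓝 0, DifferentiableAt ℝ u y :=
    hu.eventually_analyticAt.mono fun y h => h.differentiableAt
  refine ⟨4 * M1, by positivity, ?_⟩
  filter_upwards [e1, e2, e3, e4, e5, e6, h.eventually_nhds] with y h1 h2 h3 h4 h5 h6 h7
  have hline : HasDerivAt (fun s : ℝ => y + s • e) e 0 := by
    simpa using ((hasDerivAt_id (0:ℝ)).smul_const e).const_add y
  have d1 : HasDerivAt (fun s : ℝ => f (π (y + s • e))) (fderiv ℝ f (π y) (fderiv ℝ π y e)) 0 := by
    have a1 : HasFDerivAt π (fderiv ℝ π y) (y + (0:ℝ) • e) := by simpa using h5.hasFDerivAt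
    have a2 := a1.comp_hasDerivAt (0:ℝ) hline
    have a3 : HasFDerivAt f (fderiv ℝ f (π y)) (π (y + (0:ℝ) • e)) := by simpa using h4.hasFDerivAt
    exact a3.comp_hasDerivAt (0:ℝ) a2
  set R : ℝ := ∏ j ∈ Finset.univ.erase i, y j ^ α j with hR
  have hprod : ∀ s : ℝ, ∏ j, (y + s • e) j ^ α j = (y i + s) ^ α i * R := by
    intro s
    rw [← Finset.mul_prod_erase _ _ (Finset.mem_univ i)]
    congr 1
    · simp [he]
    · apply Finset.prod_congr rfl
      intro j hj
      simp [he, Finset.ne_of_mem_erase hj]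
  have d2 : HasDerivAt (fun s : ℝ => (y i + s) ^ α i * R * u (y + s • e))
      ((α i * y i ^ (α i - 1)) * R * u y + y i ^ α i * R * fderiv ℝ u y e) 0 := by
    have a1 : HasFDerivAt u (fderiv ℝ u y) (y + (0:ℝ) • e) := by simpa using h6.hasFDerivAt
    have a2 := a1.comp_hasDerivAt (0:ℝ) hline
    have a3 : HasDerivAt (fun s : ℝ => (y i + s) ^ α i * R) ((α i * y i ^ (α i - 1)) * R) 0 := by
      have := (((hasDerivAt_id (0:ℝ)).const_add (y i)).pow (α i)).mul_const R
      simpa using this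
    have := a3.mul a2
    simp only [Function.comp_apply, zero_smul, add_zero] at this
    exact this
  have heq : (fun s : ℝ => f (π (y + s • e))) =ᶠ[𝓝 0] fun s => (y i + s) ^ α i * R * u (y + s • e) := by
    have ht : Tendsto (fun s : ℝ => y + s • e) (𝓝 0) (𝓝 y) := by
      have := hline.continuousAt.tendsto
      simpa using this
    filter_upwards [ht.eventually h7] with s hs
    rw [hs, hprod]
  have hd := d1.unique (d2.congr_of_eventuallyEq heq)
  have hy := h7.self_of_nhds
  have hp0 := hprod 0
  simp only [zero_smul, add_zero] at hp0
  have hmain : y i * fderiv ℝ f (π y) (fderiv ℝ π y e) = (∏ j, y j ^ α j) * B y := by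
    rw [hd, hp0, hB]
    have : y i ^ α i = y i * y i ^ (α i - 1) := by rw [← pow_succ']; congr 1; omega
    simp only
    linear_combination (R * α i * u y) * (-this)
  have hb : ‖fderiv ℝ f (π y) (fderiv ℝ π y e)‖ ≤ ‖fderiv ℝ f (π y)‖ * M1 :=
    (ContinuousLinearMap.le_opNorm _ _).trans (mul_le_mul_of_nonneg_left h3.le (norm_nonneg _))
  rw [Real.norm_eq_abs] at hb
  set Q := |∏ j, y j ^ α j| with hQ
  have hQ0 : 0 ≤ Q := abs_nonneg _
  have hm2 : |y i| * |fderiv ℝ f (π y) (fderiv ℝ π y e)| = Q * |B y| := by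
    rw [← abs_mul, hmain, abs_mul]
  rw [hy, abs_mul]
  calc Q * |u y| ≤ Q * (4 * |B y|) := mul_le_mul_of_nonneg_left (by linarith) hQ0
    _ = 4 * (|y i| * |fderiv ℝ f (π y) (fderiv ℝ π y e)|) := by rw [hm2]; ring
    _ ≤ 4 * (|y i| * (‖fderiv ℝ f (π y)‖ * M1)) := by gcongr
    _ = _ := by ring

theorem mono_loj {n : ℕ} {f : (Fin n → ℝ) → ℝ} {π : (Fin n → ℝ) → (Fin n → ℝ)}
    (hf : AnalyticAt ℝ f 0) (hf0 : f 0 = 0) (hπ : AnalyticAt ℝ π 0) (hπ0 : π 0 = 0)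
    (h : NC (cE n) (fun y => f (π y))) :
    ∃ (M : ℝ) (m : ℕ), 1 ≤ m ∧ ∀ᶠ y in 𝓝 0, f (π y) ≠ 0 →
      |f (π y)| ^ (1 - 1 / (m:ℝ)) ≤ M * ‖fderiv ℝ f (π y)‖ := by
  obtain ⟨α, u, hu, hu0, h⟩ := h
  have h' : ∀ᶠ y in 𝓝 0, f (π y) = (∏ j, y j ^ α j) * u y := h
  set m := ∑ i, α i with hm
  have hm1 : 1 ≤ m := by
    by_contra hcon
    have hm0 : m = 0 := by omega
    have h0 : ∀ i, α i = 0 := by simpa [hm] using hm0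
    have := h'.self_of_nhds
    simp [hπ0, hf0, h0] at this
    exact hu0 this.symm
  have : ∀ i, ∃ M : ℝ, 0 < M ∧ (α i ≠ 0 → ∀ᶠ y in 𝓝 0,
      |f (π y)| ≤ M * (|y i| * ‖fderiv ℝ f (π y)‖)) := by
    intro i
    by_cases hi : α i = 0
    · exact ⟨1, one_pos, fun h => absurd hi h⟩
    · obtain ⟨M, h1, h2⟩ := coord_est hf hπ hπ0 α u hu hu0 h' i hi
      exact ⟨M, h1, fun _ => h2⟩
  choose M hMpos hM using this
  set K : ℝ := ∏ i, M i ^ α i with hK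
  have hKpos : 0 < K := Finset.prod_pos fun i _ => pow_pos (hMpos i) _
  have hup : 0 < |u 0| := abs_pos.2 hu0
  have e1 : ∀ᶠ y in 𝓝 0, |u 0| / 2 < |u y| :=
    continuousAt_const.eventually_lt hu.continuousAt.abs (by linarith)
  have e2 : ∀ᶠ y : Fin n → ℝ in 𝓝 0, ∀ i, α i ≠ 0 → |f (π y)| ≤ M i * (|y i| * ‖fderiv ℝ f (π y)‖) := by
    rw [eventually_all]
    intro i
    by_cases hi : α i = 0
    · exact Eventually.of_forall fun y h => absurd hi h
    · exact (hM i hi).mono fun y h _ => h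
  set K' := K * (2 / |u 0|) with hK'
  have hKp' : 0 < K' := by positivity
  refine ⟨K' ^ (1 / (m:ℝ)), m, hm1, ?_⟩
  filter_upwards [e1, e2, h'] with y h1 h2 h3 hne
  set G := ‖fderiv ℝ f (π y)‖ with hG
  have hG0 : 0 ≤ G := norm_nonneg _
  have hfp : 0 < |f (π y)| := abs_pos.2 hne
  have hle : |f (π y)| ^ m ≤ K * (∏ i, |y i| ^ α i) * G ^ m := by
    have e : K * (∏ i, |y i| ^ α i) * G ^ m = ∏ i, (M i * (|y i| * G)) ^ α i := by
      simp only [mul_pow, Finset.prod_mul_distrib, Finset.prod_pow_eq_pow_sum, ← hm, hK]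
      ring
    rw [e, hm, ← Finset.prod_pow_eq_pow_sum]
    apply Finset.prod_le_prod
    · intro i _; positivity
    · intro i _
      by_cases hi : α i = 0
      · simp [hi]
      · exact pow_le_pow_left₀ (abs_nonneg _) (h2 i hi) _
  have habs : (∏ i, |y i| ^ α i) ≤ |f (π y)| * (2 / |u 0|) := by
    rw [h3, abs_mul, Finset.abs_prod]
    simp only [abs_pow]
    have : 1 ≤ |u y| * (2 / |u 0|) := by
      rw [mul_div_assoc', le_div_iff₀ hup]; linarith
    rw [mul_assoc]
    exact le_mul_of_one_le_right (Finset.prod_nonneg fun i _ => by positivity) this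
  have hle2 : |f (π y)| ^ (m - 1) ≤ K' * G ^ m := by
    have e : |f (π y)| ^ m = |f (π y)| ^ (m - 1) * |f (π y)| := by
      rw [← pow_succ]; congr 1; omega
    rw [e] at hle
    have : |f (π y)| ^ (m - 1) * |f (π y)| ≤ (K' * G ^ m) * |f (π y)| := by
      refine hle.trans ?_
      calc K * (∏ i, |y i| ^ α i) * G ^ m ≤ K * (|f (π y)| * (2 / |u 0|)) * G ^ m := by gcongr
        _ = _ := by rw [hK']; ring
    exact le_of_mul_le_mul_right this hfp
  have hm0 : (m:ℝ) ≠ 0 := by positivity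
  have := Real.rpow_le_rpow (by positivity) hle2 (show 0 ≤ 1 / (m:ℝ) by positivity)
  rw [Real.mul_rpow hKp'.le (by positivity), ← Real.rpow_natCast, ← Real.rpow_natCast G,
    ← Real.rpow_mul hfp.le, ← Real.rpow_mul hG0, mul_one_div_cancel hm0, Real.rpow_one] at this
  convert this using 2
  rw [Nat.cast_sub hm1]
  field_simp
  simp

theorem grad_ineq_pi {n : ℕ} {f : (Fin n → ℝ) → ℝ} (hf : AnalyticAt ℝ f 0) (hf0 : f 0 = 0) :
    ∃ (C θ : ℝ), 0 < C ∧ θ ∈ Set.Ioo (0:ℝ) 1 ∧ ∀ᶠ x in 𝓝 0, |f x| ^ θ ≤ C * ‖fderiv ℝ f x‖ := by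
  by_cases hz : ∀ᶠ x in 𝓝 0, f x = 0
  · refine ⟨1, 1/2, one_pos, by norm_num, ?_⟩
    filter_upwards [hz] with x hx
    rw [hx, abs_zero, Real.zero_rpow (by norm_num)]
    positivity
  by_contra hcon
  push Not at hcon
  have hex : ∀ k : ℕ, ∃ x : Fin n → ℝ, ‖x‖ < 1 / ((k:ℝ) + 1) ∧
      ((k:ℝ) + 1) * ‖fderiv ℝ f x‖ < |f x| ^ (1 - 1 / ((k:ℝ) + 2)) := by
    intro k
    have hk : (0:ℝ) ≤ k := Nat.cast_nonneg k
    have h1 := hcon ((k:ℝ) + 1) (1 - 1 / ((k:ℝ) + 2)) (by positivity) (by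
      constructor
      · have : 1 / ((k:ℝ) + 2) < 1 := by rw [div_lt_one (by positivity)]; linarith
        linarith
      · have : 0 < 1 / ((k:ℝ) + 2) := by positivity
        linarith)
    obtain ⟨x, hx, hx'⟩ := (h1.and_eventually (Metric.ball_mem_nhds (0:Fin n → ℝ)
      (show 0 < 1 / ((k:ℝ) + 1) by positivity))).exists
    exact ⟨x, by simpa using hx', hx⟩
  choose x hx1 hx2 using hex
  have hxt : Tendsto x atTop (𝓝 0) := by
    rw [tendsto_zero_iff_norm_tendsto_zero]
    exact squeeze_zero (fun k => norm_nonneg _) (fun k => (hx1 k).le) tendsto_one_div_add_atTop_nhds_zero_nat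
  have hU : ((hyperfilter ℕ : Ultrafilter ℕ) : Filter ℕ) ≤ atTop := Nat.hyperfilter_le_atTop
  obtain ⟨π, y, hπ, hπ0, hy, hyx, hNC⟩ := SS_all (hyperfilter ℕ) n f x hf hz (hxt.mono_left hU)
  obtain ⟨M, m, hm, hloj⟩ := mono_loj hf hf0 hπ hπ0 hNC
  have hsmall : ∀ᶠ k in atTop, |f (x k)| < 1 := by
    have := (hf.continuousAt.abs.tendsto.comp hxt)
    rw [hf0, abs_zero] at this
    exact this.eventually_lt_const one_pos
  obtain ⟨k, h1, h2, h3, h4, h5⟩ := ((hy.eventually hloj).and (hyx.and ((hsmall.filter_mono hU).and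
    (((eventually_ge_atTop m).filter_mono hU).and ((eventually_ge_atTop ⌈M⌉₊).filter_mono hU))))).exists
  rw [h2] at h1
  have hk : (0:ℝ) ≤ k := Nat.cast_nonneg k
  have hmk : (m:ℝ) ≤ k := by exact_mod_cast h4
  have hMk : M ≤ k := (Nat.le_ceil M).trans (by exact_mod_cast h5)
  have hm' : (1:ℝ) ≤ m := by exact_mod_cast hm
  have hpos : 0 < 1 - 1 / ((k:ℝ) + 2) := by
    have : 1 / ((k:ℝ) + 2) < 1 := by rw [div_lt_one (by positivity)]; linarith
    linarith
  have hbad := hx2 k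
  have hG := norm_nonneg (fderiv ℝ f (x k))
  have hne : f (x k) ≠ 0 := by
    intro h
    rw [h, abs_zero, Real.zero_rpow hpos.ne'] at hbad
    have : 0 ≤ ((k:ℝ) + 1) * ‖fderiv ℝ f (x k)‖ := by positivity
    linarith
  have h6 := h1 hne
  have h7 : |f (x k)| ^ (1 - 1 / ((k:ℝ) + 2)) ≤ |f (x k)| ^ (1 - 1 / (m:ℝ)) := by
    apply Real.rpow_le_rpow_of_exponent_ge (abs_pos.2 hne) h3.le
    have : 1 / ((k:ℝ) + 2) ≤ 1 / (m:ℝ) := one_div_le_one_div_of_le (by linarith) (by linarith)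
    linarith
  nlinarith


theorem norm_gradient {E : Type*} [NormedAddCommGroup E] [InnerProductSpace ℝ E] [CompleteSpace E]
    (f : E → ℝ) (x : E) : ‖gradient f x‖ = ‖fderiv ℝ f x‖ := by
  unfold gradient
  exact LinearIsometryEquiv.norm_map _ _

theorem grad_ineq {n : ℕ} {f : EuclideanSpace ℝ (Fin n) → ℝ} {p : EuclideanSpace ℝ (Fin n)}
    (hf : AnalyticAt ℝ f p) (hp : f p = 0) :
    ∃ (C θ : ℝ), 0 < C ∧ θ ∈ Set.Ioo (0:ℝ) 1 ∧ ∀ᶠ x in 𝓝 p, |f x| ^ θ ≤ C * ‖gradient f x‖ := by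
  let L : (Fin n → ℝ) ≃L[ℝ] EuclideanSpace ℝ (Fin n) := (EuclideanSpace.equiv (Fin n) ℝ).symm
  let L' : (Fin n → ℝ) →L[ℝ] EuclideanSpace ℝ (Fin n) := L
  have hg : AnalyticAt ℝ (fun z => f (p + L' z)) 0 := by
    refine AnalyticAt.fun_comp (g := f) (f := fun z => p + L' z) (by simpa using hf) ?_
    exact analyticAt_const.fun_add (L'.analyticAt 0)
  obtain ⟨C, θ, hC, hθ, h⟩ := grad_ineq_pi hg (by simpa using hp)
  refine ⟨C * (‖L'‖ + 1), θ, by positivity, hθ, ?_⟩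
  have ht : Tendsto (fun x => L.symm (x - p)) (𝓝 p) (𝓝 0) := by
    have : Continuous fun x => L.symm (x - p) := by fun_prop
    have := this.tendsto p
    simpa using this
  filter_upwards [ht.eventually h, hf.eventually_analyticAt] with x h1 h2
  have e : p + L' (L.symm (x - p)) = x := by simp [L']
  have hd : HasFDerivAt (fun z => f (p + L' z)) ((fderiv ℝ f x).comp L') (L.symm (x - p)) := by
    have a1 : HasFDerivAt (fun z => p + L' z) L' (L.symm (x - p)) := L'.hasFDerivAt.const_add p
    have a2 : HasFDerivAt f (fderiv ℝ f x) (p + L' (L.symm (x - p))) := by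
      rw [e]; exact h2.differentiableAt.hasFDerivAt
    exact HasFDerivAt.comp (g := f) (f := fun z => p + L' z) (L.symm (x - p)) a2 a1
  rw [hd.fderiv, e] at h1
  refine h1.trans ?_
  rw [norm_gradient]
  calc C * ‖(fderiv ℝ f x).comp L'‖ ≤ C * (‖fderiv ℝ f x‖ * ‖L'‖) := by
        gcongr; exact ContinuousLinearMap.opNorm_comp_le _ _
    _ ≤ C * (‖fderiv ℝ f x‖ * (‖L'‖ + 1)) := by gcongr; linarith
    _ = _ := by ring

section flow
variable {E : Type*} [NormedAddCommGroup E] [InnerProductSpace ℝ E] [CompleteSpace E]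

theorem grad_zero {f : E → ℝ} (hnn : ∀ x, 0 ≤ f x) {x : E} (hx : f x = 0) : gradient f x = 0 := by
  have : IsLocalMin f x := Eventually.of_forall fun y => by rw [hx]; exact hnn y
  have h := this.fderiv_eq_zero
  unfold gradient
  rw [h, map_zero]

theorem flow_est {f : E → ℝ} (hf : ContDiff ℝ 1 f) (hnn : ∀ x, 0 ≤ f x) {C θ : ℝ} (hC : 0 < C)
    (hθ : θ ∈ Set.Ioo (0:ℝ) 1) {B : Set E} (hB : ∀ x ∈ B, |f x| ^ θ ≤ C * ‖gradient f x‖)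
    {γ : ℝ → E} (hγ : ∀ t : ℝ, 0 ≤ t → HasDerivAt γ (-(gradient f (γ t))) t)
    {T : ℝ} (hT : 0 ≤ T) (hTB : ∀ t ∈ Set.Ico 0 T, γ t ∈ B) :
    ‖γ T - γ 0‖ ≤ C / (1 - θ) * f (γ 0) ^ (1 - θ) ∧
    ∫ t in (0:ℝ)..T, ‖gradient f (γ (max t 0))‖ ≤ C / (1 - θ) * f (γ 0) ^ (1 - θ) := by
  have hβ : 0 < 1 - θ := by linarith [hθ.2]
  set K := C / (1 - θ) with hK
  have hKp : 0 < K := by positivity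
  set φ : ℝ → ℝ := fun t => f (γ t) with hφ
  have hfd : Differentiable ℝ f := hf.differentiable one_ne_zero
  have hφd : ∀ t, 0 ≤ t → HasDerivAt φ (-‖gradient f (γ t)‖ ^ 2) t := by
    intro t ht
    have h1 := (hfd (γ t)).hasGradientAt.hasFDerivAt.comp_hasDerivAt t (hγ t ht)
    have e : (InnerProductSpace.toDual ℝ E (gradient f (γ t))) (-(gradient f (γ t)))
        = -‖gradient f (γ t)‖ ^ 2 := by
      rw [map_neg, InnerProductSpace.toDual_apply_apply, real_inner_self_eq_norm_sq]
    rw [← e]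
    exact h1
  have hanti : ∀ s t, 0 ≤ s → s ≤ t → φ t ≤ φ s := by
    have : AntitoneOn φ (Set.Ici 0) := by
      apply antitoneOn_of_deriv_nonpos (convex_Ici 0)
      · exact fun t ht => (hφd t ht).continuousAt.continuousWithinAt
      · intro t ht
        rw [interior_Ici] at ht
        exact (hφd t (le_of_lt ht)).differentiableAt.differentiableWithinAt
      · intro t ht
        rw [interior_Ici] at ht
        rw [(hφd t (le_of_lt ht)).deriv]
        simp
    intro s t hs hst
    exact this hs (hs.trans hst) hst
  have hgc : Continuous (gradient f) := by
    unfold gradient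
    exact (LinearIsometryEquiv.continuous _).comp (hf.continuous_fderiv one_ne_zero)
  have hγc : Continuous (fun t : ℝ => γ (max t 0)) := by
    rw [continuous_iff_continuousAt]
    intro t
    exact ContinuousAt.comp (g := γ) (f := fun t : ℝ => max t 0)
      (hγ (max t 0) (le_max_right _ _)).continuousAt (by fun_prop)
  have hhc : Continuous (fun t : ℝ => ‖gradient f (γ (max t 0))‖) := (hgc.comp hγc).norm
  set Bd : ℝ → ℝ := fun t => K * φ 0 ^ (1 - θ) - K * φ t ^ (1 - θ) with hBd
  set Bd' : ℝ → ℝ := fun t => if φ t = 0 then 0 else C * φ t ^ (-θ) * ‖gradient f (γ t)‖ ^ 2 with hBd'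
  have hBc : ContinuousOn Bd (Set.Icc 0 T) := by
    intro t ht
    exact (continuousAt_const.sub (continuousAt_const.mul
      ((hφd t ht.1).continuousAt.rpow_const (Or.inr hβ.le)))).continuousWithinAt
  have hBder : ∀ t ∈ Set.Ico 0 T, HasDerivWithinAt Bd (Bd' t) (Set.Ici t) t := by
    intro t ht
    by_cases hz : φ t = 0
    · have hzs : ∀ s ∈ Set.Ici t, φ s = 0 := fun s hs =>
        le_antisymm (hz ▸ hanti t s ht.1 hs) (hnn _)
      simp only [hBd', hz, if_true]
      refine (hasDerivWithinAt_const t (Set.Ici t) (Bd t)).congr ?_ rfl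
      intro s hs
      simp only [hBd, hzs s hs, hz]
    · simp only [hBd', hz, if_false]
      have h1 := (((hφd t ht.1).rpow_const (p := 1 - θ) (Or.inl hz)).const_mul K).const_sub
        (K * φ 0 ^ (1 - θ))
      refine HasDerivAt.hasDerivWithinAt ?_
      convert h1 using 1
      rw [show 1 - θ - 1 = -θ by ring, hK]
      field_simp
  have hbound : ∀ t ∈ Set.Ico 0 T, ‖gradient f (γ t)‖ ≤ Bd' t := by
    intro t ht
    by_cases hz : φ t = 0
    · simp only [hBd', hz, if_true]
      rw [grad_zero hnn hz, norm_zero]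
    · simp only [hBd', hz, if_false]
      have hp : 0 < φ t := lt_of_le_of_ne (hnn _) (Ne.symm hz)
      have h1 := hB _ (hTB t ht)
      rw [abs_of_nonneg (hnn _)] at h1
      have h2 : 1 ≤ C * φ t ^ (-θ) * ‖gradient f (γ t)‖ := by
        rw [Real.rpow_neg hp.le]
        have h3 : 0 < φ t ^ θ := Real.rpow_pos_of_pos hp θ
        have : C * (φ t ^ θ)⁻¹ * ‖gradient f (γ t)‖ = (C * ‖gradient f (γ t)‖) / φ t ^ θ := by
          field_simp
        rw [this, le_div_iff₀ h3, one_mul]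
        exact h1
      calc ‖gradient f (γ t)‖ = 1 * ‖gradient f (γ t)‖ := (one_mul _).symm
        _ ≤ C * φ t ^ (-θ) * ‖gradient f (γ t)‖ * ‖gradient f (γ t)‖ := by gcongr
        _ = _ := by ring
  have hfin : Bd T ≤ K * f (γ 0) ^ (1 - θ) := by
    have : 0 ≤ K * φ T ^ (1 - θ) := mul_nonneg hKp.le (Real.rpow_nonneg (hnn _) _)
    simp only [hBd]
    linarith
  have hB0 : Bd 0 = 0 := by simp [hBd]
  constructor
  · refine le_trans ?_ hfin
    refine image_norm_le_of_norm_deriv_right_le_deriv_boundary' (f := fun t => γ t - γ 0)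
      (f' := fun t => -(gradient f (γ t))) (a := 0) (b := T) ?_ ?_ ?_ hBc hBder ?_ ⟨hT, le_refl T⟩
    · intro t ht
      exact ((hγ t ht.1).continuousAt.sub continuousAt_const).continuousWithinAt
    · intro t ht
      exact ((hγ t ht.1).sub_const _).hasDerivWithinAt
    · simp [hB0]
    · intro t ht
      rw [norm_neg]; exact hbound t ht
  · refine le_trans ?_ hfin
    have hder : ∀ t, HasDerivAt (fun s => ∫ t in (0:ℝ)..s, ‖gradient f (γ (max t 0))‖)
        ‖gradient f (γ (max t 0))‖ t := fun t => (hhc.integral_hasStrictDerivAt 0 t).hasDerivAt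
    refine image_le_of_deriv_right_le_deriv_boundary
      (f := fun s => ∫ t in (0:ℝ)..s, ‖gradient f (γ (max t 0))‖)
      (f' := fun t => ‖gradient f (γ (max t 0))‖) (a := 0) (b := T) ?_ ?_ ?_ hBc hBder ?_ ⟨hT, le_refl T⟩
    · intro t ht
      exact (hder t).continuousAt.continuousWithinAt
    · intro t ht
      exact (hder t).hasDerivWithinAt
    · simp [hB0]
    · intro t ht
      rw [max_eq_left ht.1]; exact hbound t ht

theorem flow_main {f : E → ℝ} (hf : ContDiff ℝ 1 f) (hnn : ∀ x, 0 ≤ f x) {C θ : ℝ} (hC : 0 < C)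
    (hθ : θ ∈ Set.Ioo (0:ℝ) 1) {p : E} {r : ℝ}
    (hB : ∀ x ∈ Metric.ball p r, |f x| ^ θ ≤ C * ‖gradient f x‖)
    {γ : ℝ → E} (hγ : ∀ t : ℝ, 0 ≤ t → HasDerivAt γ (-(gradient f (γ t))) t)
    (h0 : dist (γ 0) p < r / 2) (h1 : C / (1 - θ) * f (γ 0) ^ (1 - θ) < r / 2) :
    (∃ q, Tendsto γ atTop (𝓝 q)) ∧
    (∫⁻ t in Set.Ioi (0 : ℝ), (‖gradient f (γ t)‖₊ : ENNReal)) ≤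
      ENNReal.ofReal (C / (1 - θ) * f (γ 0) ^ (1 - θ)) := by
  have hgc : Continuous (gradient f) := by
    unfold gradient
    exact (LinearIsometryEquiv.continuous _).comp (hf.continuous_fderiv one_ne_zero)
  have hγc : Continuous (fun t : ℝ => γ (max t 0)) := by
    rw [continuous_iff_continuousAt]
    intro t
    exact ContinuousAt.comp (g := γ) (f := fun t : ℝ => max t 0)
      (hγ (max t 0) (le_max_right _ _)).continuousAt (by fun_prop)
  have hhc : Continuous (fun t : ℝ => gradient f (γ (max t 0))) := hgc.comp hγc
  have hr : 0 < r := by have := dist_nonneg (x := γ 0) (y := p); linarith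
  have hstay : ∀ t, 0 ≤ t → γ t ∈ Metric.ball p r := by
    by_contra hcon
    push Not at hcon
    obtain ⟨t, ht, htb⟩ := hcon
    set S : Set ℝ := Set.Ici 0 ∩ {t | r ≤ dist (γ (max t 0)) p} with hS
    have hSc : IsClosed S :=
      isClosed_Ici.inter (isClosed_le continuous_const (hγc.dist continuous_const))
    have hSn : S.Nonempty := ⟨t, ht, by
      simp only [Set.mem_setOf_eq, max_eq_left ht]
      simpa using htb⟩
    have hSb : BddBelow S := ⟨0, fun s hs => hs.1⟩
    have hT := hSc.csInf_mem hSn hSb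
    set T := sInf S
    have hT0 : 0 ≤ T := hT.1
    have hT2 : r ≤ dist (γ T) p := by
      have := hT.2
      simp only [Set.mem_setOf_eq, max_eq_left hT0] at this
      exact this
    have hin : ∀ s ∈ Set.Ico 0 T, γ s ∈ Metric.ball p r := by
      intro s hs
      by_contra hc
      have : s ∈ S := ⟨hs.1, by
        simp only [Set.mem_setOf_eq, max_eq_left hs.1]
        simpa using hc⟩
      exact absurd (csInf_le hSb this) (not_le.2 hs.2)
    have := (flow_est hf hnn hC hθ hB hγ hT0 hin).1
    rw [← dist_eq_norm] at this
    have := dist_triangle (γ T) (γ 0) p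
    linarith
  set I := C / (1 - θ) * f (γ 0) ^ (1 - θ) with hI
  have hest : ∀ T, 0 ≤ T → ∫ t in (0:ℝ)..T, ‖gradient f (γ (max t 0))‖ ≤ I := fun T hT =>
    (flow_est hf hnn hC hθ hB hγ hT fun t ht => hstay t ht.1).2
  have hintg : IntegrableOn (fun t : ℝ => gradient f (γ (max t 0))) (Set.Ioi 0) :=
    integrableOn_Ioi_of_intervalIntegral_norm_bounded I 0
      (fun i => (hhc.integrableOn_Ioc)) (tendsto_id (α := ℝ) (x := atTop)) (by
      filter_upwards [eventually_ge_atTop (0:ℝ)] with T hT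
      exact hest T hT)
  constructor
  · refine ⟨_, tendsto_limUnder_of_hasDerivAt_of_integrableOn_Ioi (a := 0)
      (f' := fun t => -(gradient f (γ (max t 0)))) (fun t ht => ?_) hintg.neg⟩
    have ht' : (0:ℝ) ≤ t := le_of_lt ht
    simp only [max_eq_left ht']
    exact hγ t ht'
  · have h2 : ∫ t in Set.Ioi (0:ℝ), ‖gradient f (γ (max t 0))‖ ≤ I := by
      have hl := intervalIntegral_tendsto_integral_Ioi 0 hintg.norm (tendsto_id (α := ℝ) (x := atTop))
      refine le_of_tendsto hl ?_
      filter_upwards [eventually_ge_atTop (0:ℝ)] with T hT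
      exact hest T hT
    have h3 : (∫⁻ t in Set.Ioi (0 : ℝ), (‖gradient f (γ t)‖₊ : ENNReal)) =
        ∫⁻ t in Set.Ioi (0 : ℝ), ‖gradient f (γ (max t 0))‖ₑ := by
      refine setLIntegral_congr_fun measurableSet_Ioi ?_
      intro t ht
      have ht' : (0:ℝ) ≤ t := le_of_lt ht
      simp only [max_eq_left ht']
      rfl
    rw [h3, ← ofReal_integral_norm_eq_lintegral_enorm hintg]
    exact ENNReal.ofReal_le_ofReal h2
end flow

theorem lip_dist {n : ℕ} {f : EuclideanSpace ℝ (Fin n) → ℝ} (hf : ContDiff ℝ 1 f)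
    {p : EuclideanSpace ℝ (Fin n)} (hp : f p = 0) :
    ∃ L : ℝ, 0 < L ∧ ∀ᶠ x in 𝓝 p, f x ≤ L * Metric.infDist x (f ⁻¹' {0}) := by
  obtain ⟨K, s, hs, hK⟩ := hf.contDiffAt.exists_lipschitzOnWith (x := p)
  obtain ⟨ρ, hρ, hball⟩ := Metric.mem_nhds_iff.1 hs
  refine ⟨K + 1, by positivity, ?_⟩
  filter_upwards [Metric.ball_mem_nhds p (half_pos hρ)] with x hx
  have hcl : IsClosed (f ⁻¹' {0}) := isClosed_singleton.preimage hf.continuous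
  obtain ⟨z, hz, hd⟩ := hcl.exists_infDist_eq_dist ⟨p, hp⟩ x
  have h1 : dist x z ≤ dist x p := hd ▸ Metric.infDist_le_dist_of_mem (show p ∈ f ⁻¹' {0} from hp)
  rw [Metric.mem_ball] at hx
  have h2 : dist z p < ρ := by
    have := dist_triangle z x p
    rw [dist_comm z x] at this
    linarith
  have h3 := hK.dist_le_mul x (hball (by rw [Metric.mem_ball]; linarith)) z (hball h2)
  rw [show f z = 0 from hz, Real.dist_eq, sub_zero] at h3
  rw [hd]
  have := le_abs_self (f x)
  nlinarith [dist_nonneg (x := x) (y := z)]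


/-- Near a zero `p` of a nonnegative analytic function `f`, every
gradient flow starting at `x₀` close to `p` converges, with total arclength bounded by
`C · dist(x₀, f⁻¹(0))^β` for some `C > 0` and `β ∈ (0,1)`. -/
theorem gradient_flow_length_bounded_by_dist_to_zero_set
    (n : ℕ)
    (f : EuclideanSpace ℝ (Fin n) → ℝ)
    (hf : ∀ x, AnalyticAt ℝ f x)
    (hnonneg : ∀ x, 0 ≤ f x)
    (p : EuclideanSpace ℝ (Fin n))
    (hp : f p = 0) :
    ∃ U ∈ nhds p, ∃ C : ℝ, 0 < C ∧ ∃ β : ℝ, β ∈ Set.Ioo (0 : ℝ) 1 ∧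
      ∀ (γ : ℝ → EuclideanSpace ℝ (Fin n)) (x₀ : EuclideanSpace ℝ (Fin n)),
        (∀ t : ℝ, 0 ≤ t → HasDerivAt γ (-(gradient f (γ t))) t) →
        γ 0 = x₀ → x₀ ∈ U →
        (∃ q : EuclideanSpace ℝ (Fin n), Tendsto γ atTop (nhds q)) ∧
        (∫⁻ t in Set.Ioi (0 : ℝ), (‖gradient f (γ t)‖₊ : ENNReal))
          ≤ ENNReal.ofReal (C * Metric.infDist x₀ (f ⁻¹' {0}) ^ β) := by
  have hcd : ContDiff ℝ 1 f := contDiff_iff_contDiffAt.2 fun x => (hf x).contDiffAt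
  obtain ⟨C, θ, hC, hθ, h⟩ := grad_ineq (hf p) hp
  obtain ⟨r, hr, hB⟩ := Metric.eventually_nhds_iff_ball.1 h
  obtain ⟨L, hL, hLip⟩ := lip_dist hcd hp
  have hβ : 0 < 1 - θ := by linarith [hθ.2]
  have hK : 0 < C / (1 - θ) := div_pos hC hβ
  have hcont : ContinuousAt (fun x => C / (1 - θ) * f x ^ (1 - θ)) p :=
    continuousAt_const.mul (hcd.continuous.continuousAt.rpow_const (Or.inr hβ.le))
  have hev : ∀ᶠ x in nhds p, C / (1 - θ) * f x ^ (1 - θ) < r / 2 := by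
    have h1 : C / (1 - θ) * f p ^ (1 - θ) < r / 2 := by
      rw [hp, Real.zero_rpow hβ.ne', mul_zero]
      exact half_pos hr
    exact hcont.eventually_lt_const h1
  have hev2 : ∀ᶠ x in nhds p, dist x p < r / 2 := Metric.ball_mem_nhds p (half_pos hr)
  refine ⟨_, (hev2.and (hev.and hLip)), C / (1 - θ) * L ^ (1 - θ),
    mul_pos hK (Real.rpow_pos_of_pos hL _), 1 - θ, ⟨hβ, by linarith [hθ.1]⟩, ?_⟩
  intro γ x₀ hγ h0 hx
  obtain ⟨g1, g2, g3⟩ := hx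
  subst h0
  obtain ⟨c1, c2⟩ := flow_main hcd hnonneg hC hθ hB hγ g1 g2
  refine ⟨c1, c2.trans (ENNReal.ofReal_le_ofReal ?_)⟩
  rw [mul_assoc, ← Real.mul_rpow hL.le Metric.infDist_nonneg]
  exact mul_le_mul_of_nonneg_left (Real.rpow_le_rpow (hnonneg _) g3 hβ.le) hK.le
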